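/- arXiv:2203.00646 — 6 statements merged into one kernel-verified Lean document; each statement's English description precedes it below -/
import Mathlib

section
/- For every prime $p$ and all integers $n\ge 1$ and $e\ge 0$, $f_n(p^e) = \sum_{i=0}^{e}\sum_{j=1}^{n}\binom{n-1}{j-1} f_{n-j}(p^{e-i})\, g_j(p^i)$, where by convention $f_0(p^0)=1$ and $f_0(p^e)=0$ for $e>0$. -/
/-- The number of subrings of index `k` in `ℤ^n`: finite-index additive subgroups of
`Fin n → ℤ` containing `(1,…,1)`, closed under componentwise multiplication,
and of index `k`.  (For `n = 0` this gives `1` if `k = 1` and `0` otherwise,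
matching the convention `f₀(p⁰)=1`, `f₀(pᵉ)=0` for `e>0`.) -/
noncomputable def numSubrings (n k : ℕ) : ℕ :=
  Nat.card {S : AddSubgroup (Fin n → ℤ) //
    (1 : Fin n → ℤ) ∈ S ∧
    (∀ x y : Fin n → ℤ, x ∈ S → y ∈ S → x * y ∈ S) ∧
    S.index = k}

/-- The number of irreducible (w.r.t. `p`) subrings of index `pᵉ` in `ℤ^n`:
subrings all of whose elements have all coordinates congruent modulo `p`. -/
noncomputable def numIrrSubrings (p n e : ℕ) : ℕ :=
  Nat.card {S : AddSubgroup (Fin n → ℤ) //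
    (1 : Fin n → ℤ) ∈ S ∧
    (∀ x y : Fin n → ℤ, x ∈ S → y ∈ S → x * y ∈ S) ∧
    S.index = p ^ e ∧
    (∀ x ∈ S, ∀ i j : Fin n, (x i : ZMod p) = (x j : ZMod p))}

/-- `S` is a subring of `ℤ^ι` of index `k`. -/
def IsSubringOfIndex {ι : Type*} (k : ℕ) (S : AddSubgroup (ι → ℤ)) : Prop :=
  (1 : ι → ℤ) ∈ S ∧ (∀ x y : ι → ℤ, x ∈ S → y ∈ S → x * y ∈ S) ∧ S.index = k

/-- `S` is a subring of `ℤ^ι` of index `p ^ e`, irreducible with respect to `p`. -/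
def IsIrrSubringOfIndex {ι : Type*} (p e : ℕ) (S : AddSubgroup (ι → ℤ)) : Prop :=
  (1 : ι → ℤ) ∈ S ∧ (∀ x y : ι → ℤ, x ∈ S → y ∈ S → x * y ∈ S) ∧ S.index = p ^ e ∧
    (∀ x ∈ S, ∀ i j : ι, (x i : ZMod p) = (x j : ZMod p))

/-- Reindexing the coordinates, as an additive equivalence. -/
def reindexAddEquiv {ι κ : Type*} (σ : ι ≃ κ) : (ι → ℤ) ≃+ (κ → ℤ) where
  toFun x j := x (σ.symm j)
  invFun y i := y (σ i)
  left_inv x := by ext; simp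
  right_inv y := by ext; simp
  map_add' _ _ := rfl

theorem isSubringOfIndex_map_iff {ι κ : Type*} (σ : ι ≃ κ) (k : ℕ) (S : AddSubgroup (ι → ℤ)) :
    IsSubringOfIndex k S ↔
      IsSubringOfIndex k ((reindexAddEquiv σ).mapAddSubgroup S) := by
  have mem_map (y : κ → ℤ) : y ∈ (reindexAddEquiv σ).mapAddSubgroup S ↔ (fun i => y (σ i)) ∈ S :=
    AddSubgroup.mem_map_equiv (f := reindexAddEquiv σ)
  have index_map : ((reindexAddEquiv σ).mapAddSubgroup S).index = S.index :=
    AddSubgroup.index_map_equiv S (reindexAddEquiv σ)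
  simp only [IsSubringOfIndex, mem_map, index_map]
  refine and_congr Iff.rfl (and_congr ⟨fun h x y hx hy => h _ _ hx hy, fun h x y hx hy => ?_⟩
    Iff.rfl)
  have := h (fun j => x (σ.symm j)) (fun j => y (σ.symm j)) (by simpa using hx) (by simpa using hy)
  simpa [Pi.mul_def] using this

theorem isIrrSubringOfIndex_iff {ι : Type*} {p e : ℕ} {S : AddSubgroup (ι → ℤ)} :
    IsIrrSubringOfIndex p e S ↔
      IsSubringOfIndex (p ^ e) S ∧ ∀ x ∈ S, ∀ i j : ι, (x i : ZMod p) = (x j : ZMod p) := by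
  simp only [IsIrrSubringOfIndex, IsSubringOfIndex, and_assoc]

theorem isIrrSubringOfIndex_map_iff {ι κ : Type*} (σ : ι ≃ κ) (p e : ℕ)
    (S : AddSubgroup (ι → ℤ)) :
    IsIrrSubringOfIndex p e S ↔
      IsIrrSubringOfIndex p e ((reindexAddEquiv σ).mapAddSubgroup S) := by
  have mem_map (y : κ → ℤ) : y ∈ (reindexAddEquiv σ).mapAddSubgroup S ↔ (fun i => y (σ i)) ∈ S :=
    AddSubgroup.mem_map_equiv (f := reindexAddEquiv σ)
  rw [isIrrSubringOfIndex_iff, isIrrSubringOfIndex_iff, isSubringOfIndex_map_iff σ]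
  refine and_congr Iff.rfl ⟨fun h y hy i j => ?_, fun h x hx i j => ?_⟩
  · simpa using h _ ((mem_map y).1 hy) (σ.symm i) (σ.symm j)
  · simpa using h (fun j => x (σ.symm j)) ((mem_map _).2 (by simpa using hx)) (σ i) (σ j)

theorem card_isSubringOfIndex (ι : Type*) [Fintype ι] (k : ℕ) :
    Nat.card {S : AddSubgroup (ι → ℤ) // IsSubringOfIndex k S} =
      numSubrings (Fintype.card ι) k :=
  Nat.card_congr (Equiv.subtypeEquiv (reindexAddEquiv (Fintype.equivFin ι)).mapAddSubgroup.toEquiv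
    (isSubringOfIndex_map_iff _ k))

theorem card_isIrrSubringOfIndex (ι : Type*) [Fintype ι] (p e : ℕ) :
    Nat.card {S : AddSubgroup (ι → ℤ) // IsIrrSubringOfIndex p e S} =
      numIrrSubrings p (Fintype.card ι) e :=
  Nat.card_congr (Equiv.subtypeEquiv (reindexAddEquiv (Fintype.equivFin ι)).mapAddSubgroup.toEquiv
    (isIrrSubringOfIndex_map_iff _ p e))

theorem mem_of_forall_index_dvd {ι : Type*} {k : ℕ} {S : AddSubgroup (ι → ℤ)} (hS : S.index = k)
    {x : ι → ℤ} (hx : ∀ i, (k : ℤ) ∣ x i) : x ∈ S := by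
  choose c hc using hx
  have : x = k • c := by ext i; simp [hc]
  rw [this, ← hS]
  exact S.nsmul_index_mem c

theorem finite_isSubringOfIndex (ι : Type*) [Finite ι] {k : ℕ} (hk : k ≠ 0) :
    Finite {S : AddSubgroup (ι → ℤ) // IsSubringOfIndex k S} := by
  have : NeZero k := ⟨hk⟩
  refine Finite.of_injective
    (fun S => ((fun (x : ι → ℤ) i => (x i : ZMod k)) '' (S.1 : Set (ι → ℤ)) : Set (ι → ZMod k))) ?_
  have key (S T : AddSubgroup (ι → ℤ)) (hT : IsSubringOfIndex k T)
      (h : (fun (x : ι → ℤ) i => (x i : ZMod k)) '' (S : Set (ι → ℤ)) =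
        (fun (x : ι → ℤ) i => (x i : ZMod k)) '' (T : Set (ι → ℤ))) : S ≤ T := by
    intro x hx
    obtain ⟨y, hy, hyx⟩ : (fun i => (x i : ZMod k)) ∈
        (fun (x : ι → ℤ) i => (x i : ZMod k)) '' (T : Set (ι → ℤ)) := h ▸ ⟨x, hx, rfl⟩
    have hxy : x - y ∈ T := mem_of_forall_index_dvd hT.2.2 fun i => by
      rw [← ZMod.intCast_zmod_eq_zero_iff_dvd, Pi.sub_apply, Int.cast_sub, sub_eq_zero]
      exact (congrFun hyx i).symm
    simpa using T.add_mem hxy hy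
  rintro ⟨S, hS⟩ ⟨T, hT⟩ h
  exact Subtype.ext (le_antisymm (key S T hT h) (key T S hS h.symm))

theorem finite_isIrrSubringOfIndex (ι : Type*) [Finite ι] {p : ℕ} (hp : p ≠ 0) (e : ℕ) :
    Finite {S : AddSubgroup (ι → ℤ) // IsIrrSubringOfIndex p e S} :=
  have := finite_isSubringOfIndex ι (pow_ne_zero e hp)
  Finite.of_injective
    (fun S => (⟨S.1, (isIrrSubringOfIndex_iff.1 S.2).1⟩ :
      {S : AddSubgroup (ι → ℤ) // IsSubringOfIndex (p ^ e) S}))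
    fun _ _ h => Subtype.ext (congrArg (fun T => T.1) h)

section Block

variable {ι : Type*}

open Classical in
/-- The coordinates congruent modulo `p` to the coordinate `o` on all of `S`. -/
noncomputable def congruenceBlock [Fintype ι] (p : ℕ) (o : ι) (S : AddSubgroup (ι → ℤ)) : Finset ι :=
  Finset.univ.filter fun i => ∀ x ∈ S, (x o : ZMod p) = (x i : ZMod p)

theorem mem_congruenceBlock [Fintype ι] {p : ℕ} {o i : ι} {S : AddSubgroup (ι → ℤ)} :
    i ∈ congruenceBlock p o S ↔ ∀ x ∈ S, (x o : ZMod p) = (x i : ZMod p) := by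
  simp [congruenceBlock]

theorem indicator_congruenceBlock_mem [Fintype ι] [DecidableEq ι] {p : ℕ} (hp : p.Prime)
    {e : ℕ} (o : ι) {S : AddSubgroup (ι → ℤ)} (hS : IsSubringOfIndex (p ^ e) S) :
    (fun i => if i ∈ congruenceBlock p o S then 1 else 0 : ι → ℤ) ∈ S := by
  have : Fact p.Prime := ⟨hp⟩
  obtain ⟨h1, hmul, hidx⟩ := hS
  have hpow (x : ι → ℤ) (hx : x ∈ S) (n : ℕ) : x ^ n ∈ S := by
    induction n with
    | zero => simpa using h1
    | succ n ih => rw [pow_succ]; exact hmul _ _ ih hx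
  set B := congruenceBlock p o S with hB
  have separate (k : ι) : ∃ y ∈ S, (k ∉ B → y k = 0) ∧ ∀ i ∈ B, (y i : ZMod p) = 1 := by
    by_cases hk : k ∈ B
    · exact ⟨1, h1, by simp [hk], by simp⟩
    · have hk' := hk
      rw [hB, mem_congruenceBlock] at hk'
      push Not at hk'
      obtain ⟨x, hx, hne⟩ := hk'
      have hk1 : x - (x k) • (1 : ι → ℤ) ∈ S := S.sub_mem hx (S.zsmul_mem h1 _)
      refine ⟨_, hpow _ hk1 (p - 1), fun _ => ?_, fun i hi => ?_⟩
      · simp [Nat.sub_ne_zero_of_lt hp.one_lt]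
      · have hi' := mem_congruenceBlock.1 hi x hx
        simp only [Pi.pow_apply, Pi.sub_apply, Pi.smul_apply, Pi.one_apply, smul_eq_mul, mul_one,
          Int.cast_pow, Int.cast_sub]
        apply ZMod.pow_card_sub_one_eq_one
        rw [← hi']
        exact sub_ne_zero.2 hne
  choose y hyS hy0 hy1 using separate
  have hprod (s : Finset ι) : ∏ k ∈ s, y k ∈ S := by
    induction s using Finset.induction_on with
    | empty => simpa using h1
    | insert a s ha ih => rw [Finset.prod_insert ha]; exact hmul _ _ (hyS a) ih
  set u := ∏ k, y k with hu
  have hu0 (i : ι) (hi : i ∉ B) : u i = 0 := by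
    rw [hu, Finset.prod_apply]
    exact Finset.prod_eq_zero (Finset.mem_univ i) (hy0 i hi)
  have hu1 (i : ι) (hi : i ∈ B) : (p : ℤ) ∣ u i - 1 := by
    rw [← ZMod.intCast_zmod_eq_zero_iff_dvd, hu, Finset.prod_apply]
    push_cast
    rw [Finset.prod_eq_one fun k _ => hy1 k i hi, sub_self]
  have hdiff : u ^ p ^ e - (fun i => if i ∈ B then 1 else 0 : ι → ℤ) ∈ S := by
    refine mem_of_forall_index_dvd hidx fun i => ?_
    by_cases hi : i ∈ B
    · have := dvd_sub_pow_of_dvd_sub (hu1 i hi) e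
      rw [one_pow] at this
      simp only [Pi.sub_apply, Pi.pow_apply, hi, if_true]
      push_cast
      exact (pow_dvd_pow _ (Nat.le_succ e)).trans this
    · simp [hi, hu0, hp.ne_zero]
  simpa using S.sub_mem (hpow u (hprod _) (p ^ e)) hdiff

/-- Splitting the coordinates into those in `B` and those outside `B`. -/
def splitAddEquiv [DecidableEq ι] (B : Finset ι) :
    (ι → ℤ) ≃+ ({i // i ∈ B} → ℤ) × ({i // i ∉ B} → ℤ) :=
  (RingEquiv.piEquivPiSubtypeProd (fun i => i ∈ B) fun _ => ℤ).toAddEquiv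

/-- The subgroup of `ℤ^ι` that is the product of a subgroup on the coordinates in `B` and a
subgroup on the remaining coordinates. -/
def glue [DecidableEq ι] (B : Finset ι) (S : AddSubgroup ({i // i ∈ B} → ℤ))
    (T : AddSubgroup ({i // i ∉ B} → ℤ)) : AddSubgroup (ι → ℤ) :=
  (S.prod T).comap (splitAddEquiv B : (ι → ℤ) →+ _)

theorem mem_glue [DecidableEq ι] {B : Finset ι} {S : AddSubgroup ({i // i ∈ B} → ℤ)}
    {T : AddSubgroup ({i // i ∉ B} → ℤ)} {x : ι → ℤ} :
    x ∈ glue B S T ↔ (fun i => x i : {i // i ∈ B} → ℤ) ∈ S ∧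
      (fun i => x i : {i // i ∉ B} → ℤ) ∈ T := Iff.rfl

theorem index_glue [DecidableEq ι] (B : Finset ι) (S : AddSubgroup ({i // i ∈ B} → ℤ))
    (T : AddSubgroup ({i // i ∉ B} → ℤ)) : (glue B S T).index = S.index * T.index := by
  rw [glue, AddSubgroup.index_comap_of_surjective _ (splitAddEquiv B).surjective,
    AddSubgroup.index_prod]

theorem symm_mem_glue [DecidableEq ι] {B : Finset ι} {S : AddSubgroup ({i // i ∈ B} → ℤ)}
    {T : AddSubgroup ({i // i ∉ B} → ℤ)} {x : {i // i ∈ B} → ℤ} {y : {i // i ∉ B} → ℤ} :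
    (splitAddEquiv B).symm (x, y) ∈ glue B S T ↔ x ∈ S ∧ y ∈ T := by
  simp [glue, AddSubgroup.mem_prod]

theorem glue_injective [DecidableEq ι] {B : Finset ι} {S S' : AddSubgroup ({i // i ∈ B} → ℤ)}
    {T T' : AddSubgroup ({i // i ∉ B} → ℤ)} (h : glue B S T = glue B S' T') :
    S = S' ∧ T = T' := by
  constructor
  · ext x
    have := symm_mem_glue (S := S) (T := T) (x := x) (y := 0)
    rw [h, symm_mem_glue] at this
    simpa [T.zero_mem, T'.zero_mem] using this.symm
  · ext y
    have := symm_mem_glue (S := S) (T := T) (x := 0) (y := y)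
    rw [h, symm_mem_glue] at this
    simpa [S.zero_mem, S'.zero_mem] using this.symm

theorem isSubringOfIndex_glue [DecidableEq ι] {B : Finset ι} {S : AddSubgroup ({i // i ∈ B} → ℤ)}
    {T : AddSubgroup ({i // i ∉ B} → ℤ)} {k l : ℕ} (hS : IsSubringOfIndex k S)
    (hT : IsSubringOfIndex l T) : IsSubringOfIndex (k * l) (glue B S T) :=
  ⟨⟨hS.1, hT.1⟩, fun _ _ hx hy => ⟨hS.2.1 _ _ hx.1 hy.1, hT.2.1 _ _ hx.2 hy.2⟩,
    by rw [index_glue, hS.2.2, hT.2.2]⟩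

theorem congruenceBlock_glue [Fintype ι] [DecidableEq ι] {p : ℕ} (hp : p.Prime)
    {e : ℕ} {o : ι} {B : Finset ι} (ho : o ∈ B)
    {S : AddSubgroup ({i // i ∈ B} → ℤ)} {T : AddSubgroup ({i // i ∉ B} → ℤ)}
    (hS : IsIrrSubringOfIndex p e S) : congruenceBlock p o (glue B S T) = B := by
  have : Fact p.Prime := ⟨hp⟩
  ext i
  rw [mem_congruenceBlock]
  refine ⟨fun h => ?_, fun hi x hx => hS.2.2.2 _ hx.1 ⟨o, ho⟩ ⟨i, hi⟩⟩
  by_contra hi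
  have hmem : (fun j => if j ∈ B then 1 else 0 : ι → ℤ) ∈ glue B S T := by
    rw [mem_glue]
    constructor
    · convert hS.1 with j
      simp
    · convert T.zero_mem with j
      simp [j.2]
  simpa [ho, hi] using h _ hmem

theorem exists_eq_glue [DecidableEq ι] {B : Finset ι} {S : AddSubgroup (ι → ℤ)} {k : ℕ}
    (hS : IsSubringOfIndex k S) (hB : (fun i => if i ∈ B then 1 else 0 : ι → ℤ) ∈ S) :
    ∃ S₁ S₂ l m, l * m = k ∧ IsSubringOfIndex l S₁ ∧ IsSubringOfIndex m S₂ ∧ S = glue B S₁ S₂ := by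
  obtain ⟨h1, hmul, hidx⟩ := hS
  let r₁ : (ι → ℤ) →+ ({i // i ∈ B} → ℤ) := ⟨⟨fun x i => x i, rfl⟩, fun _ _ => rfl⟩
  let r₂ : (ι → ℤ) →+ ({i // i ∉ B} → ℤ) := ⟨⟨fun x i => x i, rfl⟩, fun _ _ => rfl⟩
  have hglue : S = glue B (S.map r₁) (S.map r₂) := by
    refine le_antisymm (fun x hx => ⟨⟨x, hx, rfl⟩, ⟨x, hx, rfl⟩⟩) ?_
    rintro x ⟨⟨y, hy, hyx⟩, ⟨z, hz, hzx⟩⟩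
    have : x = y * (fun i => if i ∈ B then 1 else 0) +
        z * (1 - fun i => if i ∈ B then 1 else 0) := by
      ext i
      by_cases hi : i ∈ B
      · have : y i = x i := congrFun hyx ⟨i, hi⟩
        simp [hi, this]
      · have : z i = x i := congrFun hzx ⟨i, hi⟩
        simp [hi, this]
    rw [this]
    exact S.add_mem (hmul _ _ hy hB) (hmul _ _ hz (S.sub_mem h1 hB))
  refine ⟨S.map r₁, S.map r₂, _, _, ?_, ⟨⟨1, h1, rfl⟩, ?_, rfl⟩, ⟨⟨1, h1, rfl⟩, ?_, rfl⟩, hglue⟩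
  · rw [← index_glue, ← hglue, hidx]
  · rintro _ _ ⟨x, hx, rfl⟩ ⟨y, hy, rfl⟩
    exact ⟨x * y, hmul _ _ hx hy, rfl⟩
  · rintro _ _ ⟨x, hx, rfl⟩ ⟨y, hy, rfl⟩
    exact ⟨x * y, hmul _ _ hx hy, rfl⟩

/-- The subrings with a given block are the products of an irreducible subring on the block and
a subring on the complement. -/
theorem card_congruenceBlock_eq [Fintype ι] [DecidableEq ι] {p : ℕ} (hp : p.Prime)
    (e : ℕ) {o : ι} {B : Finset ι} (ho : o ∈ B) :
    Nat.card {S : {S : AddSubgroup (ι → ℤ) // IsSubringOfIndex (p ^ e) S} //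
        congruenceBlock p o S.1 = B} =
      ∑ i ∈ Finset.range (e + 1),
        numSubrings (Fintype.card ι - B.card) (p ^ (e - i)) * numIrrSubrings p B.card i := by
  let Pieces (i : Fin (e + 1)) : Type _ :=
    {S : AddSubgroup ({i // i ∈ B} → ℤ) // IsIrrSubringOfIndex p i S} ×
      {T : AddSubgroup ({i // i ∉ B} → ℤ) // IsSubringOfIndex (p ^ (e - i)) T}
  have hfin (i : Fin (e + 1)) : Finite (Pieces i) := by
    have := finite_isIrrSubringOfIndex {i // i ∈ B} hp.ne_zero i
    have := finite_isSubringOfIndex {i // i ∉ B} (pow_ne_zero (e - i) hp.ne_zero)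
    exact inferInstanceAs (Finite (_ × _))
  have hcard (i : Fin (e + 1)) : Nat.card (Pieces i) =
      numSubrings (Fintype.card ι - B.card) (p ^ (e - i)) * numIrrSubrings p B.card i := by
    rw [Nat.card_prod, card_isIrrSubringOfIndex, card_isSubringOfIndex, mul_comm,
      Fintype.card_subtype_compl, Fintype.card_coe]
  let f (P : Σ i, Pieces i) : {S : {S : AddSubgroup (ι → ℤ) // IsSubringOfIndex (p ^ e) S} //
      congruenceBlock p o S.1 = B} :=
    ⟨⟨glue B P.2.1.1 P.2.2.1, by
      have hI := P.2.1.2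
      have := isSubringOfIndex_glue (isIrrSubringOfIndex_iff.1 hI).1 P.2.2.2
      rwa [← pow_add, Nat.add_sub_cancel' (Nat.lt_succ_iff.1 P.1.2)] at this⟩,
      congruenceBlock_glue hp ho P.2.1.2⟩
  have hf : Function.Bijective f := by
    constructor
    · rintro ⟨i, ⟨S, hS⟩, ⟨T, hT⟩⟩ ⟨i', ⟨S', hS'⟩, ⟨T', hT'⟩⟩ h
      obtain ⟨rfl, rfl⟩ := glue_injective (congrArg (fun X => X.1.1) h)
      obtain rfl : i = i' := Fin.ext (Nat.pow_right_injective hp.two_le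
        (hS.2.2.1.symm.trans hS'.2.2.1))
      rfl
    · rintro ⟨⟨S, hS⟩, hB⟩
      have hmem := indicator_congruenceBlock_mem hp o hS
      simp only at hB
      rw [hB] at hmem
      obtain ⟨S₁, S₂, l, m, hlm, h₁, h₂, hglue⟩ := exists_eq_glue hS hmem
      obtain ⟨i, hi, rfl⟩ := (Nat.dvd_prime_pow hp).1 ⟨m, hlm.symm⟩
      obtain rfl : m = p ^ (e - i) := by
        rw [← Nat.add_sub_cancel' hi, pow_add] at hlm
        simpa using Nat.eq_of_mul_eq_mul_left (pow_pos hp.pos i) hlm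
      have hirr (x) (hx : x ∈ S₁) (a b : {i // i ∈ B}) : (x a : ZMod p) = (x b : ZMod p) := by
        have hx' : (splitAddEquiv B).symm (x, 0) ∈ S := by
          rw [hglue, symm_mem_glue]
          exact ⟨hx, S₂.zero_mem⟩
        have hval (a : {i // i ∈ B}) : (splitAddEquiv B).symm (x, 0) a = x a :=
          congrFun (congrArg Prod.fst ((splitAddEquiv B).apply_symm_apply (x, 0))) a
        have ha := mem_congruenceBlock.1 (hB.symm.subset a.2) _ hx'
        have hb := mem_congruenceBlock.1 (hB.symm.subset b.2) _ hx'
        rw [← hval a, ← hval b, ← ha, ← hb]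
      exact ⟨⟨⟨i, Nat.lt_succ_of_le hi⟩, ⟨S₁, isIrrSubringOfIndex_iff.2 ⟨h₁, hirr⟩⟩, ⟨S₂, h₂⟩⟩,
        Subtype.ext (Subtype.ext hglue.symm)⟩
  rw [← Nat.card_congr (Equiv.ofBijective f hf), Nat.card_sigma, Finset.sum_range]
  exact Finset.sum_congr rfl fun i _ => hcard i

end Block

theorem sum_finset_containing {ι M : Type*} [Fintype ι] [DecidableEq ι] [AddCommMonoid M] (o : ι)
    (h : Finset ι → M) (F : ℕ → M) (h_mem : ∀ B, o ∈ B → h B = F B.card)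
    (h_notMem : ∀ B, o ∉ B → h B = 0) :
    ∑ B, h B = ∑ j ∈ Finset.Icc 1 (Fintype.card ι), (Fintype.card ι - 1).choose (j - 1) • F j := by
  have hpos : 1 ≤ Fintype.card ι := Fintype.card_pos_iff.2 ⟨o⟩
  have hno : o ∉ Finset.univ.erase o := Finset.notMem_erase o _
  have hsub {t : Finset ι} (ht : t ∈ (Finset.univ.erase o).powerset) : o ∉ t :=
    fun hot => hno (Finset.mem_powerset.1 ht hot)
  rw [← Finset.powerset_univ, ← Finset.insert_erase (Finset.mem_univ o),
    Finset.sum_powerset_insert hno, Finset.sum_eq_zero fun t ht => h_notMem t (hsub ht), zero_add,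
    Finset.sum_congr rfl fun t ht => (h_mem _ (Finset.mem_insert_self o t)).trans
      (congrArg F (Finset.card_insert_of_notMem (hsub ht))),
    Finset.sum_powerset_apply_card fun j => F (j + 1), Finset.card_erase_of_mem (Finset.mem_univ o),
    Finset.card_univ, Nat.sub_add_cancel hpos, Finset.range_eq_Ico]
  exact Finset.sum_Ico_add' (fun j => (Fintype.card ι - 1).choose (j - 1) • F j) 0
    (Fintype.card ι) 1

/-- Liu's recurrence: for every prime `p`, `n ≥ 1` and `e ≥ 0`,
`fₙ(pᵉ) = ∑_{i=0}^{e} ∑_{j=1}^{n} C(n-1, j-1) f_{n-j}(p^{e-i}) g_j(pⁱ)`. -/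
theorem subring_recurrence (p : ℕ) (hp : p.Prime) (n : ℕ) (hn : 1 ≤ n) (e : ℕ) :
    numSubrings n (p ^ e) =
      ∑ i ∈ Finset.range (e + 1), ∑ j ∈ Finset.Icc 1 n,
        Nat.choose (n - 1) (j - 1) * numSubrings (n - j) (p ^ (e - i)) *
          numIrrSubrings p j i := by
  have : Finite {S : AddSubgroup (Fin n → ℤ) // IsSubringOfIndex (p ^ e) S} :=
    finite_isSubringOfIndex _ (pow_ne_zero e hp.ne_zero)
  let o : Fin n := ⟨0, hn⟩
  have hsum := sum_finset_containing o
    (fun B => Nat.card {S : {S : AddSubgroup (Fin n → ℤ) // IsSubringOfIndex (p ^ e) S} //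
      congruenceBlock p o S.1 = B})
    (fun j => ∑ i ∈ Finset.range (e + 1),
      numSubrings (Fintype.card (Fin n) - j) (p ^ (e - i)) * numIrrSubrings p j i)
    (fun B hB => card_congruenceBlock_eq hp e hB)
    (fun B hB => by
      rw [Nat.card_eq_zero]
      exact Or.inl ⟨fun S => hB (S.2 ▸ mem_congruenceBlock.2 fun _ _ => rfl)⟩)
  rw [← Nat.card_sigma, Nat.card_congr (Equiv.sigmaFiberEquiv _), Fintype.card_fin] at hsum
  calc numSubrings n (p ^ e) = _ := hsum
    _ = _ := by
      rw [Finset.sum_comm]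
      simp only [smul_eq_mul, Finset.mul_sum, mul_assoc]
end

section
/- For every prime $p$ and every integer $n\ge 1$: (i) $g_n(p^i)=0$ whenever $0\le i<n-1$; (ii) $g_n(p^{n-1})=1$; and (iii) $(p-1)\,g_n(p^n)=p^{n-1}-1$. -/
/-- The number of subgroups of prime index `p`, counted through nonzero homomorphisms to `ZMod p`:
such a subgroup is the kernel of exactly `p - 1` of them. -/
theorem card_addSubgroup_index_prime {A : Type*} [AddCommGroup A] (p : ℕ) [Fact p.Prime]
    [Finite (A →+ ZMod p)] :
    (p - 1) * Nat.card {T : AddSubgroup A // T.index = p} = Nat.card (A →+ ZMod p) - 1 := by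
  classical
  have exists_ker (T : {T : AddSubgroup A // T.index = p}) : ∃ φ : A →+ ZMod p, φ.ker = T.1 := by
    have hc : Nat.card (A ⧸ T.1) = p := T.2
    have : IsAddCyclic (A ⧸ T.1) := isAddCyclic_of_prime_card hc
    refine ⟨((zmodAddCyclicAddEquiv this).symm.trans
      (ZMod.ringEquivCongr hc).toAddEquiv).toAddMonoidHom.comp (QuotientAddGroup.mk' T.1), ?_⟩
    ext x
    simp [AddMonoidHom.mem_ker]
  have surj (φ : A →+ ZMod p) (hφ : φ ≠ 0) : Function.Surjective φ := by
    rw [← AddMonoidHom.range_eq_top]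
    have : Fact (Nat.card (ZMod p)).Prime := by rw [Nat.card_zmod]; infer_instance
    refine (AddSubgroup.eq_bot_or_eq_top_of_prime_card φ.range).resolve_left fun h => hφ ?_
    exact AddMonoidHom.range_eq_bot_iff.mp h
  have index_ker (φ : A →+ ZMod p) (hφ : φ ≠ 0) : φ.ker.index = p := by
    rw [AddSubgroup.index_ker, AddMonoidHom.range_eq_top.mpr (surj φ hφ)]
    simp
  choose F hF using exists_ker
  have F_ne (T) : F T ≠ 0 := by
    intro h
    have h1 := hF T
    have h2 := T.2
    rw [← h1, h] at h2
    have : (0 : A →+ ZMod p).ker = ⊤ := by ext; simp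
    rw [this, AddSubgroup.index_top] at h2
    exact (Fact.out : p.Prime).one_lt.ne h2
  have smul_ne (T) (c : (ZMod p)ˣ) : c.1 • F T ≠ 0 := by
    intro h
    refine F_ne T (AddMonoidHom.ext fun x => ?_)
    simpa using DFunLike.congr_fun h x
  have ker_smul (T) (c : (ZMod p)ˣ) : (c.1 • F T).ker = T.1 := by
    rw [← hF T]
    ext x
    simp [AddMonoidHom.mem_ker]
  let G : (ZMod p)ˣ × {T : AddSubgroup A // T.index = p} → {φ : A →+ ZMod p // φ ≠ 0} :=
    fun q => ⟨q.1.1 • F q.2, smul_ne q.2 q.1⟩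
  have hG : Function.Bijective G := by
    constructor
    · rintro ⟨c, T⟩ ⟨d, U⟩ h
      have h' : c.1 • F T = d.1 • F U := congrArg Subtype.val h
      have hTU : T = U := Subtype.ext (by rw [← ker_smul T c, h', ker_smul])
      subst hTU
      obtain ⟨a, ha⟩ := surj (F T) (F_ne T) 1
      have := DFunLike.congr_fun h' a
      simp only [AddMonoidHom.smul_apply, ha, smul_eq_mul, mul_one] at this
      rw [Units.ext this]
    · rintro ⟨φ, hφ⟩
      let T : {T : AddSubgroup A // T.index = p} := ⟨φ.ker, index_ker φ hφ⟩
      obtain ⟨a, ha⟩ := surj (F T) (F_ne T) 1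
      have key (x : A) : φ x = φ a * F T x := by
        have hx : x - (F T x).val • a ∈ (F T).ker := by
          simp [AddMonoidHom.mem_ker, ha]
        rw [hF T] at hx
        have hx' : φ (x - (F T x).val • a) = 0 := hx
        rw [map_sub, map_nsmul, nsmul_eq_mul, ZMod.natCast_zmod_val, sub_eq_zero] at hx'
        rw [hx', mul_comm]
      have hφa : φ a ≠ 0 := fun h => hφ (AddMonoidHom.ext fun x => by simp [key x, h])
      refine ⟨⟨Units.mk0 _ hφa, T⟩, Subtype.ext (AddMonoidHom.ext fun x => ?_)⟩
      simp [G, key x]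
  have hcard := Nat.card_congr (Equiv.ofBijective G hG)
  rw [Nat.card_prod, Nat.card_eq_fintype_card (α := (ZMod p)ˣ), ZMod.card_units] at hcard
  rw [hcard]
  have := Fintype.ofFinite (A →+ ZMod p)
  rw [Nat.card_eq_fintype_card, Nat.card_eq_fintype_card, Fintype.card_subtype_compl,
    Fintype.card_subtype_eq]

/-- Homomorphisms from `ℤ^m` to an abelian group are given by the images of the basis. -/
noncomputable def piIntHomEquiv (m : ℕ) (B : Type*) [AddCommGroup B] :
    ((Fin m → ℤ) →+ B) ≃ (Fin m → B) :=
  (addMonoidHomLequivInt ℤ).toEquiv.trans ((Pi.basisFun ℤ (Fin m)).constr ℤ).symm.toEquiv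

/-- The differences of the coordinates of a vector with its first coordinate. -/
def coordDiff (m : ℕ) : (Fin (m + 1) → ℤ) →+ (Fin m → ℤ) where
  toFun x i := x i.succ - x 0
  map_zero' := by ext; simp
  map_add' x y := by ext; simp; ring

theorem coordDiff_surjective (m : ℕ) : Function.Surjective (coordDiff m) := fun y =>
  ⟨Fin.cons 0 y, by ext; simp [coordDiff]⟩

/-- Vectors whose coordinate differences are `p` times an element of `T`. -/
def liftSubgroup (p m : ℕ) (T : AddSubgroup (Fin m → ℤ)) : AddSubgroup (Fin (m + 1) → ℤ) :=
  (T.map (nsmulAddMonoidHom p)).comap (coordDiff m)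

theorem mem_liftSubgroup {p m : ℕ} {T : AddSubgroup (Fin m → ℤ)} {x : Fin (m + 1) → ℤ} :
    x ∈ liftSubgroup p m T ↔ ∃ y ∈ T, ∀ i : Fin m, x i.succ = x 0 + p * y i := by
  simp only [liftSubgroup, AddSubgroup.mem_comap, AddSubgroup.mem_map, funext_iff]
  refine exists_congr fun y => and_congr_right fun _ => forall_congr' fun i => ?_
  simp only [nsmulAddMonoidHom_apply, coordDiff, AddMonoidHom.coe_mk, ZeroHom.coe_mk,
    Pi.smul_apply, nsmul_eq_mul]
  constructor <;> intro h <;> linarith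

theorem nsmul_pi_int_injective {p : ℕ} (hp : p ≠ 0) (m : ℕ) :
    Function.Injective (nsmulAddMonoidHom p : (Fin m → ℤ) →+ (Fin m → ℤ)) := by
  intro x y h
  ext i
  simpa [hp] using congrFun h i

theorem index_range_nsmul_pi_int {p : ℕ} [NeZero p] (m : ℕ) :
    (nsmulAddMonoidHom p : (Fin m → ℤ) →+ (Fin m → ℤ)).range.index = p ^ m := by
  let r : (Fin m → ℤ) →+ (Fin m → ZMod p) := (Int.castAddHom (ZMod p)).compLeft (Fin m)
  have hr : Function.Surjective r := fun z =>
    ⟨fun i => (z i).cast, by ext i; simp [r]⟩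
  have hk : r.ker = (nsmulAddMonoidHom p : (Fin m → ℤ) →+ (Fin m → ℤ)).range := by
    ext x
    simp only [AddMonoidHom.mem_ker, AddMonoidHom.mem_range, funext_iff]
    have h (i : Fin m) : r x i = 0 ↔ ∃ y : ℤ, p * y = x i := by
      change ((x i : ℤ) : ZMod p) = 0 ↔ _
      rw [ZMod.intCast_zmod_eq_zero_iff_dvd]
      exact exists_congr fun y => eq_comm
    simp only [Pi.zero_apply, h, Classical.skolem, nsmulAddMonoidHom_apply, Pi.smul_apply,
      nsmul_eq_mul]
  rw [← hk, AddSubgroup.index_ker, AddMonoidHom.range_eq_top.mpr hr]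
  simp

theorem index_liftSubgroup {p : ℕ} [NeZero p] (m : ℕ) (T : AddSubgroup (Fin m → ℤ)) :
    (liftSubgroup p m T).index = T.index * p ^ m := by
  rw [liftSubgroup, AddSubgroup.index_comap_of_surjective _ (coordDiff_surjective m),
    AddSubgroup.index_map_of_injective _ (nsmul_pi_int_injective (NeZero.ne p) m),
    index_range_nsmul_pi_int]

theorem liftSubgroup_injective {p : ℕ} (hp : p ≠ 0) (m : ℕ) :
    Function.Injective (liftSubgroup p m) :=
  (AddSubgroup.comap_injective (coordDiff_surjective m)).comp
    (AddSubgroup.map_injective (nsmul_pi_int_injective hp m))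

theorem one_mem_liftSubgroup (p m : ℕ) (T : AddSubgroup (Fin m → ℤ)) :
    1 ∈ liftSubgroup p m T :=
  mem_liftSubgroup.mpr ⟨0, T.zero_mem, by simp⟩

theorem cast_eq_of_mem_liftSubgroup {p m : ℕ} {T : AddSubgroup (Fin m → ℤ)}
    {x : Fin (m + 1) → ℤ} (hx : x ∈ liftSubgroup p m T) (i j : Fin (m + 1)) :
    (x i : ZMod p) = x j := by
  obtain ⟨y, -, hy⟩ := mem_liftSubgroup.mp hx
  have h (k : Fin (m + 1)) : (x k : ZMod p) = x 0 := by
    cases k using Fin.cases with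
    | zero => rfl
    | succ k => simp [hy k]
  rw [h i, h j]

theorem mul_mem_liftSubgroup {p m : ℕ} {T : AddSubgroup (Fin m → ℤ)} (hT : T.index ∣ p)
    {x x' : Fin (m + 1) → ℤ} (hx : x ∈ liftSubgroup p m T) (hx' : x' ∈ liftSubgroup p m T) :
    x * x' ∈ liftSubgroup p m T := by
  obtain ⟨y, hyT, hy⟩ := mem_liftSubgroup.mp hx
  obtain ⟨y', hyT', hy'⟩ := mem_liftSubgroup.mp hx'
  have hpT (z : Fin m → ℤ) : p • z ∈ T := by
    obtain ⟨k, hk⟩ := hT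
    rw [hk, mul_nsmul]
    exact T.nsmul_mem (T.nsmul_index_mem z) k
  refine mem_liftSubgroup.mpr ⟨x 0 • y' + x' 0 • y + p • (y * y'),
    T.add_mem (T.add_mem (T.zsmul_mem hyT' _) (T.zsmul_mem hyT _)) (hpT _), fun i => ?_⟩
  simp [hy, hy']
  ring

theorem exists_liftSubgroup_eq {p m : ℕ} {S : AddSubgroup (Fin (m + 1) → ℤ)} (h1 : 1 ∈ S)
    (hS : ∀ x ∈ S, ∀ i j : Fin (m + 1), (x i : ZMod p) = (x j : ZMod p)) :
    ∃ T, liftSubgroup p m T = S := by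
  refine ⟨(S.map (coordDiff m)).comap (nsmulAddMonoidHom p), ?_⟩
  rw [liftSubgroup, AddSubgroup.map_comap_eq_self, AddSubgroup.comap_map_eq_self]
  · intro x hx
    have hx' : x = x 0 • (1 : Fin (m + 1) → ℤ) := by
      ext k
      cases k using Fin.cases with
      | zero => simp
      | succ k => simpa [coordDiff, sub_eq_zero] using congrFun hx k
    rw [hx']
    exact S.zsmul_mem h1 _
  · rintro _ ⟨x, hx, rfl⟩
    have h (i : Fin m) : ∃ y : ℤ, x i.succ - x 0 = p * y :=
      (ZMod.intCast_eq_intCast_iff_dvd_sub _ _ p).mp (hS x hx 0 i.succ)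
    choose y hy using h
    exact ⟨y, by ext i; simp [coordDiff, hy]⟩

/-- For `k ≤ 1`, irreducible subrings of index `p ^ (m + k)` in `ℤ^(m+1)` correspond to subgroups
of index `p ^ k` in `ℤ^m`. -/
theorem numIrrSubrings_succ_add {p : ℕ} [NeZero p] (m : ℕ) {k : ℕ} (hk : k ≤ 1) :
    numIrrSubrings p (m + 1) (m + k) =
      Nat.card {T : AddSubgroup (Fin m → ℤ) // T.index = p ^ k} := by
  have hpm : p ^ m ≠ 0 := pow_ne_zero _ (NeZero.ne p)
  refine (Nat.card_congr (Equiv.ofBijective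
    (fun T => ⟨liftSubgroup p m T.1, one_mem_liftSubgroup p m T.1,
      fun x y hx hy => mul_mem_liftSubgroup (by simpa [T.2] using pow_dvd_pow p hk) hx hy,
      by rw [index_liftSubgroup, T.2, pow_add, mul_comm],
      fun x hx => cast_eq_of_mem_liftSubgroup hx⟩) ⟨?_, ?_⟩)).symm
  · intro T U h
    exact Subtype.ext (liftSubgroup_injective (NeZero.ne p) m (congrArg Subtype.val h))
  · rintro ⟨S, h1, -, hi, hS⟩
    obtain ⟨T, rfl⟩ := exists_liftSubgroup_eq h1 hS
    rw [index_liftSubgroup, pow_add, mul_comm] at hi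
    exact ⟨⟨T, Nat.eq_of_mul_eq_mul_left (Nat.pos_of_ne_zero hpm) hi⟩, rfl⟩

theorem numIrrSubrings_succ_eq_zero {p : ℕ} (hp : p.Prime) {m i : ℕ} (hi : i < m) :
    numIrrSubrings p (m + 1) i = 0 := by
  have : NeZero p := ⟨hp.ne_zero⟩
  refine Nat.card_eq_zero.mpr (Or.inl ⟨?_⟩)
  rintro ⟨S, h1, -, hind, hS⟩
  obtain ⟨T, rfl⟩ := exists_liftSubgroup_eq h1 hS
  rw [index_liftSubgroup] at hind
  have := (Nat.pow_dvd_pow_iff_le_right hp.one_lt).mp (Dvd.intro_left _ hind)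
  omega

/-- For every prime `p` and `n ≥ 1`: `gₙ(pⁱ)=0` for `i < n-1`, `gₙ(p^{n-1})=1`, and
`(p-1)·gₙ(pⁿ) = p^{n-1}-1`. -/
theorem g_small_exponents (p : ℕ) (hp : p.Prime) (n : ℕ) (hn : 1 ≤ n) :
    (∀ i : ℕ, i < n - 1 → numIrrSubrings p n i = 0) ∧
    numIrrSubrings p n (n - 1) = 1 ∧
    (p - 1) * numIrrSubrings p n n = p ^ (n - 1) - 1 := by
  obtain ⟨m, rfl⟩ := Nat.exists_eq_add_of_le' hn
  have : NeZero p := ⟨hp.ne_zero⟩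
  have : Fact p.Prime := ⟨hp⟩
  rw [Nat.add_sub_cancel]
  refine ⟨fun i hi => numIrrSubrings_succ_eq_zero hp hi, ?_, ?_⟩
  · have h := numIrrSubrings_succ_add (p := p) m zero_le_one
    rw [add_zero] at h
    simp [h, AddSubgroup.index_eq_one]
  · have := Finite.of_equiv _ (piIntHomEquiv m (ZMod p)).symm
    rw [numIrrSubrings_succ_add m le_rfl, pow_one, card_addSubgroup_index_prime,
      Nat.card_congr (piIntHomEquiv m (ZMod p))]
    simp
end

section
/- For every prime $p$ and every integer $n\ge 2$, $2(p-1)^2(p+1)\, g_n(p^{n+1}) = 2p^{2n-3} + (n^2-n)p^{n+1} - (n^2-n)p^{n} - (n^2-n+2)p^{n-1} + (n^2-n-2)p^{n-2} + 2$. -/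
namespace IrrSubring

/-- The homomorphism `ℤ^(m+1) → ℤ^m` subtracting the first coordinate from all the others. -/
def diffHom (m : ℕ) : (Fin (m + 1) → ℤ) →+ (Fin m → ℤ) where
  toFun x i := x i.succ - x 0
  map_zero' := by ext; simp
  map_add' x y := by ext; simp; ring

theorem diffHom_apply {m : ℕ} (x : Fin (m + 1) → ℤ) (i : Fin m) :
    diffHom m x i = x i.succ - x 0 := rfl

theorem diffHom_surjective (m : ℕ) : Function.Surjective (diffHom m) := fun y =>
  ⟨Fin.cons 0 y, by ext; simp [diffHom_apply]⟩

theorem diffHom_mul {m : ℕ} (x y : Fin (m + 1) → ℤ) :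
    diffHom m (x * y) = x 0 • diffHom m y + y 0 • diffHom m x + diffHom m x * diffHom m y := by
  ext i
  simp [diffHom_apply]
  ring

/-- Multiplication by `p` on `ℤ^m`. -/
def scaleHom (p m : ℕ) : (Fin m → ℤ) →+ (Fin m → ℤ) := nsmulAddMonoidHom p

theorem scaleHom_apply {p m : ℕ} (x : Fin m → ℤ) : scaleHom p m x = p • x := rfl

theorem scaleHom_injective {p : ℕ} (hp : p ≠ 0) (m : ℕ) :
    Function.Injective (scaleHom p m) := by
  intro x y h
  ext i
  have := congrFun h i
  simpa [scaleHom_apply, hp] using this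

theorem mem_range_scaleHom {p m : ℕ} {x : Fin m → ℤ} :
    x ∈ (scaleHom p m).range ↔ ∀ i, (x i : ZMod p) = 0 := by
  simp only [ZMod.intCast_zmod_eq_zero_iff_dvd, AddMonoidHom.mem_range]
  constructor
  · rintro ⟨y, rfl⟩ i
    exact ⟨y i, by simp [scaleHom_apply]⟩
  · intro h
    choose y hy using h
    exact ⟨y, by ext i; simp [scaleHom_apply, hy]⟩

/-- Coordinatewise reduction `ℤ^m → (ℤ/p)^m`. -/
def reduceHom (p m : ℕ) : (Fin m → ℤ) →+ (Fin m → ZMod p) where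
  toFun x i := x i
  map_zero' := by ext; simp
  map_add' x y := by ext; simp

theorem reduceHom_apply {p m : ℕ} (x : Fin m → ℤ) (i : Fin m) :
    reduceHom p m x i = (x i : ZMod p) := rfl

theorem reduceHom_surjective (p m : ℕ) : Function.Surjective (reduceHom p m) := by
  intro y
  choose x hx using fun i => ZMod.intCast_surjective (y i)
  exact ⟨x, funext hx⟩

theorem index_range_scaleHom (p m : ℕ) : (scaleHom p m).range.index = p ^ m := by
  have h : (scaleHom p m).range = (reduceHom p m).ker := by
    ext x
    rw [mem_range_scaleHom, AddMonoidHom.mem_ker, funext_iff]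
    rfl
  rw [h, AddSubgroup.index_ker, AddMonoidHom.range_eq_top.2 (reduceHom_surjective p m),
    AddSubgroup.card_top, Nat.card_fun, Nat.card_zmod, Nat.card_fin]

/-- The subgroups `M` of `ℤ^m` such that `p M` is closed under multiplication. -/
def ScaledClosed (p : ℕ) {m : ℕ} (M : AddSubgroup (Fin m → ℤ)) : Prop :=
  ∀ x ∈ M, ∀ y ∈ M, p • (x * y) ∈ M

/-- The subring `ℤ·1 + (0 × pM)` of `ℤ^(m+1)`. -/
def toSubring (p : ℕ) {m : ℕ} (M : AddSubgroup (Fin m → ℤ)) : AddSubgroup (Fin (m + 1) → ℤ) :=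
  (M.map (scaleHom p m)).comap (diffHom m)

theorem mem_toSubring {p m : ℕ} {M : AddSubgroup (Fin m → ℤ)} {x : Fin (m + 1) → ℤ} :
    x ∈ toSubring p M ↔ ∃ y ∈ M, p • y = diffHom m x := Iff.rfl

theorem toSubring_injective {p : ℕ} (hp : p ≠ 0) (m : ℕ) :
    Function.Injective (toSubring p (m := m)) :=
  (AddSubgroup.comap_injective (diffHom_surjective m)).comp
    (AddSubgroup.map_injective (scaleHom_injective hp m))

theorem index_toSubring {p : ℕ} (hp : p ≠ 0) {m : ℕ} (M : AddSubgroup (Fin m → ℤ)) :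
    (toSubring p M).index = M.index * p ^ m := by
  rw [toSubring, AddSubgroup.index_comap_of_surjective _ (diffHom_surjective m),
    AddSubgroup.index_map_of_injective _ (scaleHom_injective hp m), index_range_scaleHom]

theorem one_mem_toSubring (p : ℕ) {m : ℕ} (M : AddSubgroup (Fin m → ℤ)) : 1 ∈ toSubring p M :=
  mem_toSubring.2 ⟨0, M.zero_mem, by ext; simp [diffHom_apply]⟩

theorem mul_mem_toSubring_iff {p : ℕ} (hp : p ≠ 0) {m : ℕ} {M : AddSubgroup (Fin m → ℤ)} :
    (∀ x y, x ∈ toSubring p M → y ∈ toSubring p M → x * y ∈ toSubring p M) ↔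
      ScaledClosed p M := by
  constructor
  · intro h x hx y hy
    have key (z : Fin m → ℤ) : diffHom m (Fin.cons 0 z) = z := by ext; simp [diffHom_apply]
    obtain ⟨z, hz, hzeq⟩ := mem_toSubring.1 <| h (Fin.cons 0 (p • x)) (Fin.cons 0 (p • y))
      (mem_toSubring.2 ⟨x, hx, (key _).symm⟩) (mem_toSubring.2 ⟨y, hy, (key _).symm⟩)
    rw [diffHom_mul, key, key] at hzeq
    have : z = p • (x * y) := by
      apply scaleHom_injective hp m
      rw [scaleHom_apply, hzeq, scaleHom_apply]
      ext i
      simp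
      ring
    exact this ▸ hz
  · intro h x y hx hy
    obtain ⟨u, hu, hux⟩ := mem_toSubring.1 hx
    obtain ⟨v, hv, hvy⟩ := mem_toSubring.1 hy
    refine mem_toSubring.2 ⟨x 0 • v + y 0 • u + p • (u * v), ?_, ?_⟩
    · exact add_mem (add_mem (zsmul_mem hv _) (zsmul_mem hu _)) (h u hu v hv)
    · rw [diffHom_mul, ← hux, ← hvy]
      ext i
      simp
      ring

theorem toSubring_congr_mod (p : ℕ) {m : ℕ} (M : AddSubgroup (Fin m → ℤ)) :
    ∀ x ∈ toSubring p M, ∀ i j, (x i : ZMod p) = x j := by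
  intro x hx
  obtain ⟨u, -, hux⟩ := mem_toSubring.1 hx
  have key (i : Fin (m + 1)) : (x i : ZMod p) = x 0 := by
    refine Fin.cases rfl (fun k => ?_) i
    have := congrArg (Int.cast : ℤ → ZMod p) (congrFun hux k)
    simp only [diffHom_apply, Pi.smul_apply] at this
    simpa [eq_sub_iff_add_eq, eq_comm] using this
  intro i j
  rw [key i, key j]

theorem exists_toSubring_eq {p m : ℕ} {S : AddSubgroup (Fin (m + 1) → ℤ)} (h1 : 1 ∈ S)
    (hS : ∀ x ∈ S, ∀ i j, (x i : ZMod p) = x j) :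
    ∃ M : AddSubgroup (Fin m → ℤ), toSubring p M = S := by
  refine ⟨(S.map (diffHom m)).comap (scaleHom p m), ?_⟩
  have hle : S.map (diffHom m) ≤ (scaleHom p m).range := by
    rintro _ ⟨x, hx, rfl⟩
    refine mem_range_scaleHom.2 fun i => ?_
    simp [diffHom_apply, hS x hx i.succ 0]
  rw [toSubring, AddSubgroup.map_comap_eq_self hle, AddSubgroup.comap_map_eq_self]
  intro x hx
  have : x = x 0 • (1 : Fin (m + 1) → ℤ) := by
    ext i
    refine Fin.cases (by simp) (fun k => ?_) i
    have := congrFun ((AddMonoidHom.mem_ker).1 hx) k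
    simp only [diffHom_apply, Pi.zero_apply] at this
    simp
    lia
  rw [this]
  exact zsmul_mem h1 _

theorem numIrrSubrings_eq {p : ℕ} (hp : p ≠ 0) (m e : ℕ) :
    numIrrSubrings p (m + 1) (e + m) =
      Nat.card {M : AddSubgroup (Fin m → ℤ) // M.index = p ^ e ∧ ScaledClosed p M} := by
  have hidx (M : AddSubgroup (Fin m → ℤ)) :
      (toSubring p M).index = p ^ (e + m) ↔ M.index = p ^ e := by
    rw [index_toSubring hp, pow_add, Nat.mul_left_inj (pow_ne_zero m hp)]
  symm
  refine Nat.card_congr (Equiv.ofBijective (fun M => ⟨toSubring p M.1, one_mem_toSubring p _,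
    (mul_mem_toSubring_iff hp).2 M.2.2, (hidx _).2 M.2.1, toSubring_congr_mod p _⟩) ⟨?_, ?_⟩)
  · intro M N h
    exact Subtype.ext (toSubring_injective hp m (congrArg Subtype.val h))
  · rintro ⟨S, h1, hmul, hS, hcong⟩
    obtain ⟨M, rfl⟩ := exists_toSubring_eq h1 hcong
    exact ⟨⟨M, (hidx M).1 hS, (mul_mem_toSubring_iff hp).1 hmul⟩, rfl⟩

section Counting

variable {G A : Type*} [AddCommGroup G] [AddCommGroup A]

/-- Surjective homomorphisms `G → A` correspond to a subgroup with quotient isomorphic to `A`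
together with an automorphism of `A`. -/
noncomputable def prodAddAutEquivSurjHom (P : AddSubgroup G → Prop) :
    {M : AddSubgroup G // Nonempty (G ⧸ M ≃+ A) ∧ P M} × (A ≃+ A) ≃
      {f : G →+ A // Function.Surjective f ∧ P f.ker} := by
  let F (M : {M : AddSubgroup G // Nonempty (G ⧸ M ≃+ A) ∧ P M}) (σ : A ≃+ A) : G →+ A :=
    ((M.2.1.some.trans σ : G ⧸ M.1 ≃+ A) : G ⧸ M.1 →+ A).comp (QuotientAddGroup.mk' M.1)
  have hker (M σ) : (F M σ).ker = M.1 := by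
    ext x
    simp [F, AddMonoidHom.mem_ker]
  have hsurj (M σ) : Function.Surjective (F M σ) :=
    (M.2.1.some.trans σ).surjective.comp (QuotientAddGroup.mk'_surjective M.1)
  refine Equiv.ofBijective
    (fun x => ⟨F x.1 x.2, hsurj _ _, by rw [hker]; exact x.1.2.2⟩) ⟨?_, ?_⟩
  · rintro ⟨M, σ⟩ ⟨N, τ⟩ h
    have h' : F M σ = F N τ := congrArg Subtype.val h
    obtain rfl : M = N := Subtype.ext (by rw [← hker M σ, h', hker])
    refine Prod.ext rfl (AddEquiv.ext fun a => ?_)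
    obtain ⟨x, rfl⟩ := (M.2.1.some.surjective.comp (QuotientAddGroup.mk'_surjective M.1)) a
    exact DFunLike.congr_fun h' x
  · rintro ⟨f, hf, hP⟩
    have e := QuotientAddGroup.quotientKerEquivOfSurjective f hf
    let M : {M : AddSubgroup G // Nonempty (G ⧸ M ≃+ A) ∧ P M} := ⟨f.ker, ⟨⟨e⟩, hP⟩⟩
    refine ⟨⟨M, M.2.1.some.symm.trans
      (QuotientAddGroup.quotientKerEquivOfSurjective f hf)⟩, Subtype.ext ?_⟩
    ext x
    simp [F, M]
    rfl

theorem card_mul_card_addEquiv (P : AddSubgroup G → Prop) :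
    Nat.card {M : AddSubgroup G // Nonempty (G ⧸ M ≃+ A) ∧ P M} * Nat.card (A ≃+ A) =
      Nat.card {f : G →+ A // Function.Surjective f ∧ P f.ker} := by
  rw [← Nat.card_prod]
  exact Nat.card_congr (prodAddAutEquivSurjHom P)

theorem finite_quotient_equiv [Finite (G →+ A)] (P : AddSubgroup G → Prop) :
    Finite {M : AddSubgroup G // Nonempty (G ⧸ M ≃+ A) ∧ P M} :=
  .of_injective (fun M => prodAddAutEquivSurjHom P (M, AddEquiv.refl A)) fun M N h => by
    simpa using h

/-- The fibres of a surjective homomorphism all have the size of the kernel. -/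
theorem card_subtype_comp_surjective {f : G →+ A} (hf : Function.Surjective f) (P : A → Prop) :
    Nat.card {g // P (f g)} = Nat.card {a // P a} * Nat.card f.ker := by
  obtain ⟨s, hs⟩ := hf.hasRightInverse
  rw [← Nat.card_prod]
  refine Nat.card_congr
    { toFun g := (⟨f g, g.2⟩, ⟨g - s (f g), by simp [AddMonoidHom.mem_ker, hs _]⟩)
      invFun x := ⟨x.2 + s x.1, ?_⟩
      left_inv g := by simp
      right_inv x := ?_ }
  · have : f x.2 = 0 := x.2.2
    simpa [this, hs _] using x.1.2
  · have : f x.2 = 0 := x.2.2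
    ext <;> simp [this, hs _]

end Counting

/-- A homomorphism from `ℤ^m` is determined by the images of the standard basis. -/
noncomputable def homEquiv (m : ℕ) (A : Type*) [AddCommGroup A] :
    ((Fin m → ℤ) →+ A) ≃ (Fin m → A) :=
  (addMonoidHomLequivInt ℤ).toEquiv.trans ((Pi.basisFun ℤ (Fin m)).constr ℤ).symm.toEquiv

theorem homEquiv_symm_apply {m : ℕ} {A : Type*} [AddCommGroup A] (a : Fin m → A)
    (x : Fin m → ℤ) : (homEquiv m A).symm a x = ∑ i, x i • a i := by
  simp [homEquiv, Module.Basis.constr_apply_fintype]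

instance (m : ℕ) (A : Type*) [AddCommGroup A] [Finite A] : Finite ((Fin m → ℤ) →+ A) :=
  .of_equiv _ (homEquiv m A).symm

section Quotients

variable {p : ℕ} [hp : Fact p.Prime]

theorem card_sq_iff {Q : Type*} [AddCommGroup Q] :
    Nat.card Q = p ^ 2 ↔
      Nonempty (Q ≃+ ZMod (p ^ 2)) ∨ Nonempty (Q ≃+ (Fin 2 → ZMod p)) := by
  constructor
  · intro h
    have hfin : Finite Q := Nat.finite_of_card_ne_zero (by rw [h]; exact pow_ne_zero _ hp.1.ne_zero)
    by_cases hexp : ∀ x : Q, p • x = 0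
    · right
      obtain ⟨_⟩ : Nonempty (Module (ZMod p) Q) := ⟨AddCommGroup.zmodModule hexp⟩
      have : Module.Finite (ZMod p) Q := Module.Finite.of_finite
      have hr : Module.finrank (ZMod p) Q = 2 := by
        have : Nat.card Q = Nat.card (ZMod p) ^ Module.finrank (ZMod p) Q :=
          Module.natCard_eq_pow_finrank
        rw [h, Nat.card_zmod] at this
        exact (Nat.pow_right_injective hp.1.two_le this).symm
      have hr' : Module.finrank (ZMod p) Q = Module.finrank (ZMod p) (Fin 2 → ZMod p) := by
        simp [hr]
      exact ⟨(LinearEquiv.ofFinrankEq Q (Fin 2 → ZMod p) hr').toAddEquiv⟩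
    · left
      push Not at hexp
      obtain ⟨x, hx⟩ := hexp
      have hord : addOrderOf x = p ^ 2 :=
        addOrderOf_eq_prime_pow (n := 1) (by rwa [pow_one]) (by rw [← h]; exact card_nsmul_eq_zero')
      have hc : IsAddCyclic Q := isAddCyclic_of_addOrderOf_eq_card x (by rw [hord, h])
      rw [← h]
      exact ⟨(zmodAddCyclicAddEquiv hc).symm⟩
  · rintro (⟨⟨e⟩⟩ | ⟨⟨e⟩⟩) <;> rw [Nat.card_congr e.toEquiv] <;> simp

theorem not_cyclic_and_elementary {Q : Type*} [AddCommGroup Q] :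
    ¬ (Nonempty (Q ≃+ ZMod (p ^ 2)) ∧ Nonempty (Q ≃+ (Fin 2 → ZMod p))) := by
  rintro ⟨⟨e⟩, ⟨f⟩⟩
  have h : p • (1 : ZMod (p ^ 2)) = 0 := by
    apply (e.symm.trans f).injective
    rw [map_nsmul, map_zero]
    ext i
    simp
  rw [nsmul_one, ZMod.natCast_eq_zero_iff] at h
  have := Nat.le_of_dvd hp.1.pos h
  nlinarith [hp.1.two_le]

theorem card_index_sq_eq_add {m : ℕ} (P : AddSubgroup (Fin m → ℤ) → Prop) :
    Nat.card {M : AddSubgroup (Fin m → ℤ) // M.index = p ^ 2 ∧ P M} =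
      Nat.card {M : AddSubgroup (Fin m → ℤ) //
        Nonempty ((Fin m → ℤ) ⧸ M ≃+ ZMod (p ^ 2)) ∧ P M} +
      Nat.card {M : AddSubgroup (Fin m → ℤ) //
        Nonempty ((Fin m → ℤ) ⧸ M ≃+ (Fin 2 → ZMod p)) ∧ P M} := by
  classical
  have : NeZero p := ⟨hp.1.ne_zero⟩
  have h1 := finite_quotient_equiv (A := ZMod (p ^ 2)) P
  have h2 := finite_quotient_equiv (A := Fin 2 → ZMod p) P
  rw [← Nat.card_sum]
  refine Nat.card_congr ((Equiv.subtypeEquivRight fun M => ?_).trans (subtypeOrEquiv _ _ ?_))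
  · rw [← or_and_right, ← card_sq_iff]
    rfl
  · rw [Pi.disjoint_iff]
    intro M
    rw [Prop.disjoint_iff]
    have := not_cyclic_and_elementary (p := p) (Q := (Fin m → ℤ) ⧸ M)
    tauto

theorem card_addEquiv_zmod_sq : Nat.card (ZMod (p ^ 2) ≃+ ZMod (p ^ 2)) = p * (p - 1) := by
  have : NeZero p := ⟨hp.1.ne_zero⟩
  have h := Nat.card_congr (ZMod.AddAutEquivUnits (p ^ 2)).toEquiv
  have h' : Nat.card (Additive (ZMod (p ^ 2))ˣ) = p * (p - 1) := by
    rw [Nat.card_congr Additive.toMul, Nat.card_eq_fintype_card, ZMod.card_units_eq_totient,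
      Nat.totient_prime_pow hp.1 two_pos]
    simp
  exact h.trans h'

theorem card_addEquiv_elementary :
    Nat.card ((Fin 2 → ZMod p) ≃+ (Fin 2 → ZMod p)) = (p ^ 2 - 1) * (p ^ 2 - p) := by
  have h := Matrix.card_GL_field (𝔽 := ZMod p) 2
  rw [Fin.prod_univ_two, ZMod.card] at h
  simp only [Fin.coe_ofNat_eq_mod, Nat.zero_mod, pow_zero, Nat.one_mod, pow_one] at h
  rw [← h]
  refine Nat.card_congr (Equiv.trans ?_
    (Matrix.GeneralLinearGroup.toLin.toEquiv.trans
      (LinearMap.GeneralLinearGroup.generalLinearEquiv (ZMod p) (Fin 2 → ZMod p)).toEquiv).symm)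
  exact
    { toFun e := { e with map_smul' := ZMod.map_smul e }
      invFun e := e.toAddEquiv
      left_inv e := rfl
      right_inv e := rfl }

theorem card_elementary (m : ℕ) (P : AddSubgroup (Fin m → ℤ) → Prop)
    (hP : ∀ f : (Fin m → ℤ) →+ (Fin 2 → ZMod p), P f.ker) (hm : 1 ≤ m) :
    Nat.card {f : (Fin m → ℤ) →+ (Fin 2 → ZMod p) // Function.Surjective f ∧ P f.ker} =
      (p ^ m - 1) * (p ^ m - p) := by
  have key (A : Fin 2 → Fin m → ZMod p) :
      Function.Surjective ((homEquiv m _).symm fun i k => A k i) ↔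
        LinearIndependent (ZMod p) A := by
    have h1 : ⇑((homEquiv m (Fin 2 → ZMod p)).symm fun i k => A k i) =
        (Matrix.of A).mulVecLin ∘ reduceHom p m := by
      ext x k
      simp [homEquiv_symm_apply, Matrix.mulVec, dotProduct, reduceHom_apply, mul_comm]
    have h2 : (Matrix.of A).rank = Module.finrank (ZMod p) (Submodule.span (ZMod p) (Set.range A)) :=
      Matrix.rank_eq_finrank_span_row _
    rw [h1, (reduceHom_surjective p m).of_comp_iff, ← LinearMap.range_eq_top,
      linearIndependent_iff_card_eq_finrank_span, Set.finrank, ← h2, Matrix.rank]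
    constructor
    · intro h
      rw [h, finrank_top, Module.finrank_fin_fun, Fintype.card_fin]
    · intro h
      exact Submodule.eq_top_of_finrank_eq (by simpa using h.symm)
  have e : {f : (Fin m → ℤ) →+ (Fin 2 → ZMod p) // Function.Surjective f ∧ P f.ker} ≃
      {A : Fin 2 → Fin m → ZMod p // LinearIndependent (ZMod p) A} :=
    (((Equiv.piComm _).trans (homEquiv m (Fin 2 → ZMod p)).symm).subtypeEquiv fun A => by
      rw [← key]
      exact (and_iff_left (hP _)).symm).symm
  rw [Nat.card_congr e]
  rcases hm.eq_or_lt with rfl | hm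
  · have : IsEmpty {A : Fin 2 → Fin 1 → ZMod p // LinearIndependent (ZMod p) A} :=
      ⟨fun A => by simpa using A.2.fintype_card_le_finrank⟩
    simp
  · rw [card_linearIndependent (by rw [Module.finrank_fin_fun]; exact hm), Fin.prod_univ_two]
    simp

end Quotients

section Lines

variable {K : Type*} [Field K] {m : ℕ}

/-- The nonzero vectors `b` such that the hyperplane `b^⊥` is isotropic for the diagonal form
with coefficients `b`. -/
def IsotropicCoeff (b : Fin m → K) : Prop :=
  b ≠ 0 ∧ ∀ x y : Fin m → K, ∑ i, x i * b i = 0 → ∑ i, y i * b i = 0 → ∑ i, x i * y i * b i = 0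

/-- The vector `c (e_j - e_(t-1))`, to be read as `c e_j` when `t = 0`. -/
def lineVec (j : Fin m) (t : ℕ) (c : K) (k : Fin m) : K :=
  if k = j then c else if k.val + 1 = t then -c else 0

theorem lineVec_zero (j : Fin m) (c : K) : lineVec j 0 c = Pi.single j c := by
  ext k
  simp [lineVec, Pi.single_apply]

theorem lineVec_succ {i j : Fin m} (hij : i ≠ j) (c : K) :
    lineVec j (i.val + 1) c = Pi.single j c - Pi.single i c := by
  ext k
  by_cases hj : k = j
  · subst hj
    simp [lineVec, hij.symm]
  · by_cases hi : k = i
    · simp [lineVec, hi, hij]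
    · simp [lineVec, hi, hj, Fin.val_inj]

theorem isotropicCoeff_lineVec (j : Fin m) (t : Fin (j.val + 1)) {c : K} (hc : c ≠ 0) :
    IsotropicCoeff (lineVec j t c) := by
  refine ⟨fun h => hc (by simpa [lineVec] using congrFun h j), fun x y hx hy => ?_⟩
  rcases Fin.eq_zero_or_eq_succ t with rfl | ⟨s, rfl⟩
  · rw [Fin.val_zero, lineVec_zero] at *
    simp_all [Pi.single_apply]
  · obtain ⟨i, hi⟩ : ∃ i : Fin m, i.val = s.val := ⟨⟨s, s.2.trans j.2⟩, rfl⟩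
    have hij : i ≠ j := fun h => by have := s.2; rw [← hi, h] at this; exact this.false
    rw [Fin.val_succ, ← hi, lineVec_succ hij] at hx hy ⊢
    simp only [Pi.sub_apply, Pi.single_apply, mul_sub, mul_ite, mul_zero, Finset.sum_sub_distrib,
      Finset.sum_ite_eq', Finset.mem_univ, if_true] at hx hy ⊢
    have hx' : x j = x i := mul_right_cancel₀ hc (sub_eq_zero.1 hx)
    have hy' : y j = y i := mul_right_cancel₀ hc (sub_eq_zero.1 hy)
    rw [hx', hy', sub_self]

theorem sum_single_sub_single_mul (b : Fin m → K) (i j : Fin m) :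
    ∑ l, (Pi.single i (b j) - Pi.single j (b i) : Fin m → K) l * b l = 0 := by
  simp [Pi.single_apply, sub_mul, Finset.sum_sub_distrib, mul_comm (b i) (b j)]

theorem IsotropicCoeff.eq_neg {b : Fin m → K} (hb : IsotropicCoeff b) {i j : Fin m} (hij : i ≠ j)
    (hi : b i ≠ 0) (hj : b j ≠ 0) : b i = -b j := by
  have h := hb.2 _ _ (sum_single_sub_single_mul b i j) (sum_single_sub_single_mul b i j)
  rw [Fintype.sum_eq_add i j hij (by intro l hl; simp [hl.1, hl.2])] at h
  simp only [Pi.sub_apply, Pi.single_eq_same, Pi.single_eq_of_ne hij,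
    Pi.single_eq_of_ne hij.symm] at h
  have : b i * b j * (b i + b j) = 0 := by linear_combination h
  exact eq_neg_of_add_eq_zero_left (by simpa [hi, hj] using this)

theorem IsotropicCoeff.eq_zero {b : Fin m → K} (hb : IsotropicCoeff b) {i j k : Fin m}
    (hij : i ≠ j) (hik : i ≠ k) (hjk : j ≠ k) (hi : b i ≠ 0) (hj : b j ≠ 0) : b k = 0 := by
  have h := hb.2 _ _ (sum_single_sub_single_mul b i j) (sum_single_sub_single_mul b i k)
  rw [Fintype.sum_eq_single i] at h
  · simpa [hij, hik, hi, hj] using h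
  · intro l hl
    by_cases hlj : l = j
    · simp [hlj, hij.symm, hjk]
    · simp [hl, hlj]

theorem IsotropicCoeff.exists_lineVec {b : Fin m → K} (hb : IsotropicCoeff b) :
    ∃ (j : Fin m) (t : Fin (j.val + 1)) (c : K), c ≠ 0 ∧ lineVec j t c = b := by
  classical
  have hne : (Finset.univ.filter fun i => b i ≠ 0).Nonempty := by
    obtain ⟨i, hi⟩ := Function.ne_iff.1 hb.1
    exact ⟨i, by simpa using hi⟩
  obtain ⟨j, hj, hmax⟩ := Finset.exists_max_image _ id hne
  simp only [Finset.mem_filter, Finset.mem_univ, true_and, id] at hj hmax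
  by_cases h : ∃ i, i ≠ j ∧ b i ≠ 0
  · obtain ⟨i, hij, hi⟩ := h
    have hlt : i.val < j.val := lt_of_le_of_ne (hmax i hi) (Fin.val_ne_of_ne hij)
    refine ⟨j, ⟨i.val + 1, by lia⟩, b j, hj, ?_⟩
    rw [lineVec_succ hij]
    ext k
    by_cases hkj : k = j
    · subst hkj
      simp [hij.symm]
    by_cases hki : k = i
    · subst hki
      simp [hkj, hb.eq_neg hkj hi hj]
    · simp [hkj, hki, hb.eq_zero hij (Ne.symm hki) (Ne.symm hkj) hi hj]
  · push Not at h
    refine ⟨j, 0, b j, hj, ?_⟩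
    rw [Fin.val_zero, lineVec_zero]
    ext k
    by_cases hkj : k = j
    · simp [hkj]
    · simp [hkj, h k hkj]

theorem lineVec_apply_of_lt {j k : Fin m} {t : ℕ} (ht : t ≤ j) (hjk : j < k) (c : K) :
    lineVec j t c k = 0 := by
  have : k.val + 1 ≠ t := by have : j.val < k.val := hjk; lia
  simp [lineVec, hjk.ne', this]

theorem lineVec_injective {j j' : Fin m} {t t' : ℕ} (ht : t ≤ j) (ht' : t' ≤ j') {c c' : K}
    (hc : c ≠ 0) (hc' : c' ≠ 0) (h : lineVec j t c = lineVec j' t' c') :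
    j = j' ∧ t = t' ∧ c = c' := by
  have hj : j = j' := by
    rcases lt_trichotomy j j' with hlt | heq | hlt
    · have := congrFun h j'
      rw [lineVec_apply_of_lt ht hlt] at this
      exact absurd (by simpa [lineVec] using this.symm) hc'
    · exact heq
    · have := congrFun h j
      rw [lineVec_apply_of_lt ht' hlt] at this
      exact absurd (by simpa [lineVec] using this) hc
  subst hj
  have hcc : c = c' := by simpa [lineVec] using congrFun h j
  subst hcc
  refine ⟨rfl, ?_, rfl⟩
  have key {s s' : ℕ} (hs : s ≤ j) (h : lineVec j s c = lineVec j s' c) : s = 0 ∨ s = s' := by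
    refine or_iff_not_imp_left.2 fun h0 => by_contra fun hne => ?_
    have h1 : (⟨s - 1, by lia⟩ : Fin m) ≠ j := fun h => by
      have := congrArg Fin.val h
      simp only at this
      lia
    have h2 : s - 1 + 1 = s := by lia
    have := congrFun h ⟨s - 1, by lia⟩
    simp only [lineVec, if_neg h1, h2, if_true, if_neg hne] at this
    exact hc (neg_eq_zero.1 this)
  have h1 := key ht h
  have h2 := key ht' h.symm
  lia

theorem two_mul_card_isotropicCoeff [Finite K] :
    2 * Nat.card {b : Fin m → K // IsotropicCoeff b} = m * (m + 1) * (Nat.card K - 1) := by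
  classical
  have e : (Σ j : Fin m, Fin (j.val + 1)) × {c : K // c ≠ 0} ≃
      {b : Fin m → K // IsotropicCoeff b} := by
    refine Equiv.ofBijective
      (fun x => ⟨lineVec x.1.1 x.1.2 x.2.1, isotropicCoeff_lineVec _ _ x.2.2⟩) ⟨?_, ?_⟩
    · rintro ⟨⟨j, t⟩, c, hc⟩ ⟨⟨j', t'⟩, c', hc'⟩ h
      obtain ⟨rfl, ht, rfl⟩ := lineVec_injective (Nat.lt_succ_iff.1 t.2) (Nat.lt_succ_iff.1 t'.2)
        hc hc' (congrArg Subtype.val h)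
      obtain rfl := Fin.ext ht
      rfl
    · rintro ⟨b, hb⟩
      obtain ⟨j, t, c, hc, rfl⟩ := hb.exists_lineVec
      exact ⟨⟨⟨j, t⟩, c, hc⟩, rfl⟩
  have := Fintype.ofFinite K
  have h1 : Nat.card (Σ j : Fin m, Fin (j.val + 1)) * 2 = m * (m + 1) := by
    rw [Nat.card_sigma]
    simp only [Nat.card_fin]
    rw [Fin.sum_univ_eq_sum_range (fun i => i + 1) m]
    have h := Finset.sum_range_id_mul_two (m + 1)
    rw [Finset.sum_range_succ'] at h
    simpa [mul_comm] using h
  have h2 : Nat.card {c : K // c ≠ 0} = Nat.card K - 1 := by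
    rw [Nat.card_eq_fintype_card, Nat.card_eq_fintype_card, Fintype.card_subtype_compl]
    simp
  rw [← Nat.card_congr e, Nat.card_prod, h2, ← h1]
  ring

end Lines

section Cyclic

/-- The reduction `ℤ/p² → ℤ/p`. -/
def redSq (p : ℕ) : ZMod (p ^ 2) →+* ZMod p := ZMod.castHom (dvd_pow_self p two_ne_zero) (ZMod p)

theorem redSq_surjective (p : ℕ) : Function.Surjective (redSq p) :=
  ZMod.castHom_surjective _

variable {p : ℕ} [hp : Fact p.Prime] {m : ℕ}

theorem nsmul_eq_zero_iff_redSq (z : ZMod (p ^ 2)) : p • z = 0 ↔ redSq p z = 0 := by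
  obtain ⟨n, rfl⟩ := ZMod.natCast_zmod_surjective z
  rw [map_natCast, nsmul_eq_mul, ← Nat.cast_mul, ZMod.natCast_eq_zero_iff,
    ZMod.natCast_eq_zero_iff, pow_two, Nat.mul_dvd_mul_iff_left hp.1.pos]

theorem redSq_eq_zero_iff (z : ZMod (p ^ 2)) : redSq p z = 0 ↔ ∃ w, z = p • w := by
  obtain ⟨n, rfl⟩ := ZMod.natCast_zmod_surjective z
  constructor
  · rw [map_natCast, ZMod.natCast_eq_zero_iff]
    rintro ⟨k, rfl⟩
    exact ⟨k, by simp⟩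
  · rintro ⟨w, hw⟩
    simp [hw]

theorem isUnit_of_redSq_ne_zero {z : ZMod (p ^ 2)} (hz : redSq p z ≠ 0) : IsUnit z := by
  obtain ⟨n, rfl⟩ := ZMod.natCast_zmod_surjective z
  rw [map_natCast, Ne, ZMod.natCast_eq_zero_iff] at hz
  rw [ZMod.isUnit_iff_coprime]
  exact (((Nat.Prime.coprime_iff_not_dvd hp.1).2 hz).symm).pow_right 2

theorem redSq_homEquiv_symm (a : Fin m → ZMod (p ^ 2)) (x : Fin m → ℤ) :
    redSq p ((homEquiv m _).symm a x) = ∑ i, (x i : ZMod p) * redSq p (a i) := by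
  simp [homEquiv_symm_apply]

theorem surjective_homEquiv_symm_iff (a : Fin m → ZMod (p ^ 2)) :
    Function.Surjective ((homEquiv m _).symm a) ↔ (fun i => redSq p (a i)) ≠ 0 := by
  constructor
  · intro h h0
    obtain ⟨x, hx⟩ := h 1
    have := redSq_homEquiv_symm a x
    rw [hx, map_one] at this
    simp [fun i => congrFun h0 i] at this
  · intro h z
    obtain ⟨i, hi⟩ := Function.ne_iff.1 h
    obtain ⟨u, hu⟩ := isUnit_of_redSq_ne_zero hi
    obtain ⟨k, hk⟩ := ZMod.intCast_surjective (z * ((u⁻¹ : (ZMod (p ^ 2))ˣ) : ZMod (p ^ 2)))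
    refine ⟨Pi.single i k, ?_⟩
    rw [homEquiv_symm_apply, Fintype.sum_eq_single i (by intro j hj; simp [hj])]
    simp [hk, ← hu]

theorem scaledClosed_ker_iff {a : Fin m → ZMod (p ^ 2)}
    (ha : Function.Surjective ((homEquiv m _).symm a)) :
    ScaledClosed p ((homEquiv m _).symm a).ker ↔
      ∀ x y : Fin m → ZMod p, ∑ i, x i * redSq p (a i) = 0 → ∑ i, y i * redSq p (a i) = 0 →
        ∑ i, x i * y i * redSq p (a i) = 0 := by
  constructor
  · have lift (x : Fin m → ZMod p) (hx : ∑ i, x i * redSq p (a i) = 0) :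
        ∃ X ∈ ((homEquiv m _).symm a).ker, reduceHom p m X = x := by
      obtain ⟨X, rfl⟩ := reduceHom_surjective p m x
      obtain ⟨w, hw⟩ := (redSq_eq_zero_iff _).1 ((redSq_homEquiv_symm a X).trans hx)
      obtain ⟨W, rfl⟩ := ha w
      refine ⟨X - p • W, ?_, ?_⟩
      · rw [AddMonoidHom.mem_ker, map_sub, map_nsmul, hw, sub_self]
      · ext i
        simp [reduceHom_apply]
    intro h x y hx hy
    obtain ⟨X, hX, rfl⟩ := lift x hx
    obtain ⟨Y, hY, rfl⟩ := lift y hy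
    have := h X hX Y hY
    rw [AddMonoidHom.mem_ker, map_nsmul, nsmul_eq_zero_iff_redSq, redSq_homEquiv_symm] at this
    simpa [reduceHom_apply] using this
  · intro h x hx y hy
    rw [AddMonoidHom.mem_ker] at hx hy
    rw [AddMonoidHom.mem_ker, map_nsmul, nsmul_eq_zero_iff_redSq, redSq_homEquiv_symm]
    simpa using h (fun i => x i) (fun i => y i) (by rw [← redSq_homEquiv_symm, hx, map_zero])
      (by rw [← redSq_homEquiv_symm, hy, map_zero])

theorem two_mul_card_cyclic (m : ℕ) :
    2 * Nat.card {f : (Fin m → ℤ) →+ ZMod (p ^ 2) //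
      Function.Surjective f ∧ ScaledClosed p f.ker} = p ^ m * (m * (m + 1) * (p - 1)) := by
  have : NeZero p := ⟨hp.1.ne_zero⟩
  let R : (Fin m → ZMod (p ^ 2)) →+ (Fin m → ZMod p) := (redSq p).toAddMonoidHom.compLeft (Fin m)
  have hR : Function.Surjective R := (redSq_surjective p).comp_left
  have hker : Nat.card R.ker = p ^ m := by
    have h := card_subtype_comp_surjective hR fun _ => True
    simp only [Nat.card_congr (Equiv.subtypeUnivEquiv fun _ => trivial), Nat.card_fun,
      Nat.card_zmod, Nat.card_fin] at h
    rw [← pow_mul, mul_comm 2 m, pow_mul, pow_two] at h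
    exact (Nat.eq_of_mul_eq_mul_left (pow_pos hp.1.pos m) h).symm
  have e : {f : (Fin m → ℤ) →+ ZMod (p ^ 2) // Function.Surjective f ∧ ScaledClosed p f.ker} ≃
      {a // IsotropicCoeff (R a)} :=
    ((homEquiv m (ZMod (p ^ 2))).symm.subtypeEquiv fun a => by
      rw [and_congr_right fun h => scaledClosed_ker_iff h, surjective_homEquiv_symm_iff]
      rfl).symm
  rw [Nat.card_congr e, card_subtype_comp_surjective hR, hker, ← mul_assoc,
    two_mul_card_isotropicCoeff, Nat.card_zmod, mul_comm]

end Cyclic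

theorem two_mul_card_quotient_cyclic {p : ℕ} (hp : p.Prime) (k : ℕ) :
    2 * Nat.card {M : AddSubgroup (Fin (k + 1) → ℤ) //
      Nonempty ((Fin (k + 1) → ℤ) ⧸ M ≃+ ZMod (p ^ 2)) ∧ ScaledClosed p M} =
      p ^ k * ((k + 1) * (k + 2)) := by
  have : Fact p.Prime := ⟨hp⟩
  have h := two_mul_card_cyclic (p := p) (k + 1)
  rw [← card_mul_card_addEquiv, card_addEquiv_zmod_sq] at h
  have hpos : 0 < p * (p - 1) := Nat.mul_pos hp.pos (Nat.sub_pos_of_lt hp.one_lt)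
  refine Nat.eq_of_mul_eq_mul_right hpos ?_
  rw [mul_assoc, h]
  ring

theorem card_quotient_elementary_mul {p : ℕ} (hp : p.Prime) (k : ℕ) :
    Nat.card {M : AddSubgroup (Fin (k + 1) → ℤ) //
      Nonempty ((Fin (k + 1) → ℤ) ⧸ M ≃+ (Fin 2 → ZMod p)) ∧ ScaledClosed p M} *
      ((p ^ 2 - 1) * (p - 1)) = (p ^ (k + 1) - 1) * (p ^ k - 1) := by
  have : Fact p.Prime := ⟨hp⟩
  have h := card_elementary (p := p) (k + 1) (ScaledClosed p)
    (fun f x _ y _ => by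
      rw [AddMonoidHom.mem_ker, map_nsmul]
      ext i
      simp) (Nat.le_add_left 1 k)
  rw [← card_mul_card_addEquiv, card_addEquiv_elementary] at h
  refine Nat.eq_of_mul_eq_mul_right hp.pos ?_
  have h1 : p ^ 2 - p = (p - 1) * p := by rw [Nat.sub_one_mul, pow_two]
  have h2 : p ^ (k + 1) - p = (p ^ k - 1) * p := by rw [Nat.sub_one_mul, pow_succ]
  rw [h1, h2] at h
  rw [mul_assoc (_ - 1) _ p, ← h]
  ring

end IrrSubring

/-- For every prime `p` and `n ≥ 2`:
`2(p-1)²(p+1)·gₙ(p^{n+1}) = 2p^{2n-3} + (n²-n)p^{n+1} - (n²-n)pⁿ - (n²-n+2)p^{n-1}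
  + (n²-n-2)p^{n-2} + 2`. -/
theorem g_n_plus_one (p : ℕ) (hp : p.Prime) (n : ℕ) (hn : 2 ≤ n) :
    2 * ((p : ℤ) - 1) ^ 2 * ((p : ℤ) + 1) * (numIrrSubrings p n (n + 1) : ℤ) =
      2 * (p : ℤ) ^ (2 * n - 3) + ((n : ℤ) ^ 2 - n) * (p : ℤ) ^ (n + 1)
        - ((n : ℤ) ^ 2 - n) * (p : ℤ) ^ n - ((n : ℤ) ^ 2 - n + 2) * (p : ℤ) ^ (n - 1)
        + ((n : ℤ) ^ 2 - n - 2) * (p : ℤ) ^ (n - 2) + 2 := by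
  obtain ⟨k, rfl⟩ := Nat.exists_eq_add_of_le' hn
  have : Fact p.Prime := ⟨hp⟩
  have hsplit : numIrrSubrings p (k + 2) (k + 2 + 1) = _ :=
    (congrArg (numIrrSubrings p (k + 2)) (by ring)).trans
      (IrrSubring.numIrrSubrings_eq hp.ne_zero (k + 1) 2)
  rw [hsplit, IrrSubring.card_index_sq_eq_add]
  have hC := IrrSubring.two_mul_card_quotient_cyclic hp k
  have hE := IrrSubring.card_quotient_elementary_mul hp k
  generalize Nat.card {M : AddSubgroup (Fin (k + 1) → ℤ) //
      Nonempty ((Fin (k + 1) → ℤ) ⧸ M ≃+ ZMod (p ^ 2)) ∧ IrrSubring.ScaledClosed p M} = C at *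
  generalize Nat.card {M : AddSubgroup (Fin (k + 1) → ℤ) //
      Nonempty ((Fin (k + 1) → ℤ) ⧸ M ≃+ (Fin 2 → ZMod p)) ∧ IrrSubring.ScaledClosed p M} = E at *
  zify [Nat.one_le_pow _ _ hp.pos, hp.one_le] at hC hE
  rw [show 2 * (k + 2) - 3 = 2 * k + 1 by lia, show k + 2 - 1 = k + 1 by lia,
    show k + 2 - 2 = k by lia]
  push_cast
  linear_combination ((p : ℤ) - 1) ^ 2 * (p + 1) * hC + 2 * hE
end

section
/- Let $p$ be a prime, let $\alpha=(1,\alpha_2,\dots,\alpha_k)$ be a composition of positive integers with $k\ge 2$ whose first part equals $1$, and let $\alpha'=(\alpha_2,\dots,\alpha_k)$. Then $g_\alpha(p)=g_{\alpha'}(p)$. -/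
/-- `A` is an irreducible subring matrix for the prime `p` with diagonal given by the
composition `α = (e₁, …, e_m)` (so `A` is `(m+1) × (m+1)`): `A` is upper triangular with
diagonal `(p^{e₁}, …, p^{e_m}, 1)`, last column `(1, …, 1)ᵀ`, the above-diagonal entries
among the first `m` columns are divisible by `p` and lie in `[0, p^{eᵢ})`, and the
componentwise product of any two columns lies in the `ℤ`-span of the columns. -/
def IsIrrSubringMatrix (p : ℕ) {m : ℕ} (α : Fin m → ℕ)
    (A : Matrix (Fin (m + 1)) (Fin (m + 1)) ℤ) : Prop :=
  (∀ i j : Fin (m + 1), (j : ℕ) < (i : ℕ) → A i j = 0) ∧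
  (∀ i : Fin m, A i.castSucc i.castSucc = (p : ℤ) ^ α i) ∧
  (∀ i : Fin (m + 1), A i (Fin.last m) = 1) ∧
  (∀ i j : Fin m, (i : ℕ) < (j : ℕ) →
    (p : ℤ) ∣ A i.castSucc j.castSucc ∧ 0 ≤ A i.castSucc j.castSucc ∧
      A i.castSucc j.castSucc < (p : ℤ) ^ α i) ∧
  (∀ i j : Fin (m + 1), ∃ x : Fin (m + 1) → ℤ, A.mulVec x = fun r => A r i * A r j)

/-- `gMat p α` is the number of irreducible subring matrices with diagonal `α`. -/
noncomputable def gMat (p : ℕ) {m : ℕ} (α : Fin m → ℕ) : ℕ :=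
  Nat.card {A : Matrix (Fin (m + 1)) (Fin (m + 1)) ℤ // IsIrrSubringMatrix p α A}

/-- Prepend to `B` the column `(p, 0, …, 0)ᵀ` and, as the rest of the new first row, a copy of
the last row of `B`. -/
def extendMatrix (p : ℕ) {m : ℕ} (B : Matrix (Fin (m + 1)) (Fin (m + 1)) ℤ) :
    Matrix (Fin (m + 1 + 1)) (Fin (m + 1 + 1)) ℤ :=
  fun i => Fin.cases (Fin.cons (p : ℤ) (B (Fin.last m))) (fun i => Fin.cons 0 (B i)) i

section extendMatrix

variable (p : ℕ) {m : ℕ} (B : Matrix (Fin (m + 1)) (Fin (m + 1)) ℤ)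

@[simp] lemma extendMatrix_zero_zero : extendMatrix p B 0 0 = p := rfl

@[simp] lemma extendMatrix_zero_succ (j : Fin (m + 1)) :
    extendMatrix p B 0 j.succ = B (Fin.last m) j := rfl

@[simp] lemma extendMatrix_succ_zero (i : Fin (m + 1)) :
    extendMatrix p B i.succ 0 = 0 := rfl

@[simp] lemma extendMatrix_succ_succ (i j : Fin (m + 1)) :
    extendMatrix p B i.succ j.succ = B i j := rfl

end extendMatrix

namespace IsIrrSubringMatrix

variable {p m : ℕ}

lemma submatrix_succ {α : Fin (m + 1) → ℕ}
    {A : Matrix (Fin (m + 1 + 1)) (Fin (m + 1 + 1)) ℤ} (hA : IsIrrSubringMatrix p α A) :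
    IsIrrSubringMatrix p (fun i : Fin m => α i.succ) (A.submatrix Fin.succ Fin.succ) := by
  obtain ⟨hlow, hdiag, hlast, hent, hmul⟩ := hA
  refine ⟨fun i j hij => hlow _ _ (by simpa using hij), fun i => ?_, fun i => ?_,
    fun i j hij => ?_, fun i j => ?_⟩
  · simpa using hdiag i.succ
  · simpa using hlast i.succ
  · simpa using hent i.succ j.succ (by simpa using hij)
  · obtain ⟨x, hx⟩ := hmul i.succ j.succ
    refine ⟨fun k => x k.succ, funext fun r => ?_⟩
    have hr := congrFun hx r.succ
    have h0 : A r.succ 0 = 0 := hlow _ _ (by simp)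
    simpa [Matrix.mulVec, dotProduct, Fin.sum_univ_succ (n := m + 1), h0] using hr

lemma last_castSucc {α : Fin m → ℕ} {B : Matrix (Fin (m + 1)) (Fin (m + 1)) ℤ}
    (hB : IsIrrSubringMatrix p α B) (j : Fin m) : B (Fin.last m) j.castSucc = 0 :=
  hB.1 _ _ (by simp)

lemma extend (hp : 0 < p) {α : Fin (m + 1) → ℕ} (h1 : α 0 = 1)
    {B : Matrix (Fin (m + 1)) (Fin (m + 1)) ℤ}
    (hB : IsIrrSubringMatrix p (fun i : Fin m => α i.succ) B) :
    IsIrrSubringMatrix p α (extendMatrix p B) := by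
  have hrow := hB.last_castSucc
  obtain ⟨hlow, hdiag, hlast, hent, hmul⟩ := hB
  refine ⟨fun i j hij => ?_, fun i => ?_, fun i => ?_, fun i j hij => ?_, fun i j => ?_⟩
  · cases i using Fin.cases with
    | zero => simp at hij
    | succ i =>
      cases j using Fin.cases with
      | zero => simp
      | succ j => exact hlow i j (by simpa using hij)
  · cases i using Fin.cases with
    | zero => simp [h1]
    | succ i => simpa using hdiag i
  · rw [← Fin.succ_last]
    cases i using Fin.cases with
    | zero => exact hlast _
    | succ i => exact hlast i
  · cases j using Fin.cases with
    | zero => simp at hij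
    | succ j =>
      cases i using Fin.cases with
      | zero => simp [hrow, h1, hp]
      | succ i => simpa [← Fin.succ_castSucc] using hent i j (by simpa using hij)
  · cases i using Fin.cases with
    | zero =>
      refine ⟨Pi.single 0 (extendMatrix p B 0 j), funext fun r => ?_⟩
      cases r using Fin.cases <;> simp
    | succ i =>
      cases j using Fin.cases with
      | zero =>
        refine ⟨Pi.single 0 (extendMatrix p B 0 i.succ), funext fun r => ?_⟩
        cases r using Fin.cases <;> simp [mul_comm]
      | succ j =>
        obtain ⟨x, hx⟩ := hmul i j
        refine ⟨Fin.cons 0 x, funext fun r => ?_⟩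
        cases r using Fin.cases with
        | zero =>
          simpa [Matrix.mulVec, dotProduct, Fin.sum_univ_succ (n := m + 1)]
            using congrFun hx (Fin.last m)
        | succ r =>
          simpa [Matrix.mulVec, dotProduct, Fin.sum_univ_succ (n := m + 1)] using congrFun hx r

lemma extendMatrix_submatrix_succ {α : Fin (m + 1) → ℕ} (h1 : α 0 = 1)
    {A : Matrix (Fin (m + 1 + 1)) (Fin (m + 1 + 1)) ℤ} (hA : IsIrrSubringMatrix p α A) :
    extendMatrix p (A.submatrix Fin.succ Fin.succ) = A := by
  have hrow := hA.submatrix_succ.last_castSucc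
  obtain ⟨hlow, hdiag, hlast, hent, -⟩ := hA
  ext i j
  cases i using Fin.cases with
  | zero =>
    cases j using Fin.cases with
    | zero => simpa [h1] using (hdiag 0).symm
    | succ j =>
      rw [extendMatrix_zero_succ]
      cases j using Fin.lastCases with
      | last => simp [hlast]
      | cast j =>
        obtain ⟨hdvd, hnonneg, hlt⟩ := hent 0 j.succ (by simp)
        rw [h1, pow_one] at hlt
        rw [hrow]
        exact (Int.eq_zero_of_dvd_of_nonneg_of_lt hnonneg hlt hdvd).symm
  | succ i =>
    cases j using Fin.cases with
    | zero => exact (hlow i.succ 0 (by simp)).symm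
    | succ j => rfl

end IsIrrSubringMatrix

/-- Dropping a leading part equal to `1` from a composition does not change the count of
irreducible subring matrices: if `α = (1, α₂, …, α_k)` (with `k = m+1 ≥ 2` parts) and
`α' = (α₂, …, α_k)`, then `g_α(p) = g_{α'}(p)`. -/
theorem gMat_tail (p : ℕ) (hp : p.Prime) (m : ℕ) (hm : 1 ≤ m)
    (α : Fin (m + 1) → ℕ) (hpos : ∀ i, 0 < α i) (h1 : α 0 = 1) :
    gMat p α = gMat p (fun i : Fin m => α i.succ) :=
  Nat.card_congr
    { toFun := fun A => ⟨A.1.submatrix Fin.succ Fin.succ, A.2.submatrix_succ⟩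
      invFun := fun B => ⟨extendMatrix p B.1, B.2.extend hp.pos h1⟩
      left_inv := fun A => Subtype.ext (A.2.extendMatrix_submatrix_succ h1)
      right_inv := fun _ => rfl }
end

section
/- Let $p$ be a prime, let $n\ge 2$, and let $\alpha=(4,1,\dots,1)$ be the composition of length $n-1$ with first part $4$ and all other parts $1$. Then $g_\alpha(p)=(n-1)p^{n-2}$. -/
namespace FourOnes

variable {k : ℕ}

/-- The upper triangular matrix with diagonal `(p ^ 4, p, …, p, 1)`, last column `1`, first row
`(p ^ 4, p * b 0, …, p * b (k - 1), 1)`, and zeros elsewhere. -/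
def mat (p : ℕ) (b : Fin k → ℤ) : Matrix (Fin (k + 1 + 1)) (Fin (k + 1 + 1)) ℤ :=
  Fin.snoc (α := fun _ => Fin (k + 1 + 1) → ℤ)
    (Fin.cons (α := fun _ => Fin (k + 1 + 1) → ℤ)
      (Fin.snoc (α := fun _ => ℤ) (Fin.cons (α := fun _ => ℤ) ((p : ℤ) ^ 4) fun j => p * b j) 1)
      fun i => Fin.snoc (α := fun _ => ℤ)
        (Fin.cons (α := fun _ => ℤ) 0 fun j => if i = j then (p : ℤ) else 0) 1)
    (Fin.snoc (α := fun _ => ℤ) (fun _ => 0) 1)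

theorem forall_fin {P : Fin (k + 1 + 1) → Prop} :
    (∀ i, P i) ↔ P (Fin.castSucc 0) ∧ (∀ j : Fin k, P j.succ.castSucc) ∧ P (Fin.last _) := by
  rw [Fin.forall_fin_succ', Fin.forall_fin_succ, and_assoc]

section entries

variable (p : ℕ) (b : Fin k → ℤ) (i j : Fin k)

theorem mat_zero_zero : mat p b (Fin.castSucc 0) (Fin.castSucc 0) = (p : ℤ) ^ 4 := by
  simp only [mat, Fin.snoc_castSucc, Fin.cons_zero]

theorem mat_zero_mid : mat p b (Fin.castSucc 0) j.succ.castSucc = p * b j := by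
  simp only [mat, Fin.snoc_castSucc, Fin.cons_zero, Fin.cons_succ]

theorem mat_mid_zero : mat p b i.succ.castSucc (Fin.castSucc 0) = 0 := by
  simp only [mat, Fin.snoc_castSucc, Fin.cons_zero, Fin.cons_succ]

theorem mat_mid_mid :
    mat p b i.succ.castSucc j.succ.castSucc = if i = j then (p : ℤ) else 0 := by
  simp only [mat, Fin.snoc_castSucc, Fin.cons_succ]

theorem mat_last_castSucc (l : Fin (k + 1)) : mat p b (Fin.last _) l.castSucc = 0 := by
  simp only [mat, Fin.snoc_castSucc, Fin.snoc_last]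

theorem mat_last (i : Fin (k + 1 + 1)) : mat p b i (Fin.last _) = 1 := by
  revert i
  rw [forall_fin]
  simp only [mat, Fin.snoc_castSucc, Fin.snoc_last, Fin.cons_zero, Fin.cons_succ, implies_true,
    and_self]

theorem mat_mulVec_eq_iff (x v : Fin (k + 1 + 1) → ℤ) :
    (mat p b).mulVec x = v ↔
      (p : ℤ) ^ 4 * x (Fin.castSucc 0) + ∑ j : Fin k, p * b j * x j.succ.castSucc + x (Fin.last _)
        = v (Fin.castSucc 0) ∧
      (∀ j : Fin k, p * x j.succ.castSucc + x (Fin.last _) = v j.succ.castSucc) ∧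
      x (Fin.last _) = v (Fin.last _) := by
  rw [funext_iff, forall_fin]
  simp only [Matrix.mulVec, dotProduct, Fin.sum_univ_castSucc (n := k + 1),
    Fin.sum_univ_succ (n := k), mat_zero_zero, mat_zero_mid, mat_mid_zero, mat_mid_mid,
    mat_last_castSucc, mat_last, ite_mul, zero_mul, Finset.sum_ite_eq, Finset.mem_univ, if_true,
    one_mul, zero_add, Finset.sum_const_zero]

end entries

theorem exists_mulVec_mid_iff {p : ℕ} (hp : p ≠ 0) (b : Fin k → ℤ) (i j : Fin k) :
    (∃ x, (mat p b).mulVec x =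
        fun r => mat p b r i.succ.castSucc * mat p b r j.succ.castSucc) ↔
      (p : ℤ) ^ 2 ∣ b i * b j - if i = j then b j else 0 := by
  have hp' : (p : ℤ) ≠ 0 := by exact_mod_cast hp
  simp only [mat_mulVec_eq_iff, mat_zero_mid, mat_mid_mid, mat_last_castSucc]
  constructor
  · rintro ⟨x, h0, hm, hl⟩
    have hx : ∀ l : Fin k, x l.succ.castSucc =
        if l = j then (if i = j then (p : ℤ) else 0) else 0 := by
      intro l
      apply mul_left_cancel₀ hp'
      have := hm l
      rw [hl] at this
      split_ifs at this ⊢ <;> simp_all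
    simp only [hx, mul_ite, mul_zero, Finset.sum_ite_eq', Finset.mem_univ, if_true, hl] at h0
    refine ⟨x (Fin.castSucc 0), mul_left_cancel₀ (pow_ne_zero 2 hp') ?_⟩
    split_ifs at h0 ⊢ <;> linear_combination -h0
  · rintro ⟨c, hc⟩
    refine ⟨Fin.snoc (α := fun _ => ℤ) (Fin.cons (α := fun _ => ℤ) c
      fun l => if l = j then (if i = j then (p : ℤ) else 0) else 0) 0, ?_, ?_, ?_⟩
    · simp only [Fin.snoc_castSucc, Fin.snoc_last, Fin.cons_zero, Fin.cons_succ, mul_ite, mul_zero,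
        Finset.sum_ite_eq', Finset.mem_univ, if_true]
      split_ifs at hc ⊢ <;> linear_combination -(p : ℤ) ^ 2 * hc
    · intro l
      simp only [Fin.snoc_castSucc, Fin.snoc_last, Fin.cons_succ]
      split_ifs <;> simp_all
    · simp only [Fin.snoc_last, mul_zero]

theorem exists_mulVec_of_left_zero (p : ℕ) (b : Fin k → ℤ) (j : Fin (k + 1 + 1)) :
    ∃ x, (mat p b).mulVec x = fun r => mat p b r (Fin.castSucc 0) * mat p b r j := by
  refine ⟨Pi.single (Fin.castSucc 0) (mat p b (Fin.castSucc 0) j), ?_⟩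
  rw [Matrix.mulVec_single, funext_iff, forall_fin]
  simp only [Pi.smul_apply, Matrix.col_apply, op_smul_eq_mul, mat_mid_zero, mat_last_castSucc,
    zero_mul, implies_true, and_self]

theorem exists_mulVec_of_left_last (p : ℕ) (b : Fin k → ℤ) (j : Fin (k + 1 + 1)) :
    ∃ x, (mat p b).mulVec x = fun r => mat p b r (Fin.last _) * mat p b r j := by
  refine ⟨Pi.single j 1, ?_⟩
  ext r
  simp [mat_last]

theorem forall_exists_mulVec_iff {p : ℕ} (hp : p ≠ 0) (b : Fin k → ℤ) :
    (∀ i j, ∃ x, (mat p b).mulVec x = fun r => mat p b r i * mat p b r j) ↔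
      ∀ i j : Fin k, (p : ℤ) ^ 2 ∣ b i * b j - if i = j then b j else 0 := by
  simp only [← exists_mulVec_mid_iff hp]
  refine ⟨fun h i j => h _ _, fun h => ?_⟩
  rw [forall_fin]
  refine ⟨exists_mulVec_of_left_zero p b, fun i => ?_, exists_mulVec_of_left_last p b⟩
  rw [forall_fin]
  refine ⟨?_, h i, ?_⟩
  · simpa only [mul_comm] using exists_mulVec_of_left_zero p b i.succ.castSucc
  · simpa only [mul_comm] using exists_mulVec_of_left_last p b i.succ.castSucc

theorem mat_injective {p : ℕ} (hp : p ≠ 0) : Function.Injective (mat (k := k) p) := by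
  intro b c h
  ext j
  have := congr_fun (congr_fun h (Fin.castSucc 0)) j.succ.castSucc
  rw [mat_zero_mid, mat_zero_mid] at this
  exact mul_left_cancel₀ (by exact_mod_cast hp) this

/-- The irreducible subring matrices with diagonal `(p ^ 4, p, …, p, 1)`. -/
theorem isIrrSubringMatrix_iff {p : ℕ} (hp : p ≠ 0)
    (A : Matrix (Fin (k + 1 + 1)) (Fin (k + 1 + 1)) ℤ) :
    IsIrrSubringMatrix p (fun i : Fin (k + 1) => if (i : ℕ) = 0 then 4 else 1) A ↔
      ∃ b : Fin k → ℤ, A = mat p b ∧ (∀ j, 0 ≤ b j ∧ b j < (p : ℤ) ^ 3) ∧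
        ∀ i j : Fin k, (p : ℤ) ^ 2 ∣ b i * b j - if i = j then b j else 0 := by
  have hp' : (0 : ℤ) < p := by exact_mod_cast Nat.pos_of_ne_zero hp
  constructor
  · rintro ⟨htri, hdiag, hlast, hup, hmul⟩
    have h0 : ∀ j : Fin k, ∃ c : ℤ, A (Fin.castSucc 0) j.succ.castSucc = p * c :=
      fun j => (hup 0 j.succ (by simp)).1
    choose b hb using h0
    have hA : A = mat p b := by
      have h : ∀ i j, A i j = mat p b i j := by
        simp only [forall_fin (k := k), mat_zero_zero, mat_zero_mid, mat_mid_zero, mat_mid_mid,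
          mat_last_castSucc, mat_last, hlast, hb, and_true, implies_true]
        refine ⟨by simpa using hdiag 0, fun i => ⟨htri _ _ (by simp), fun j => ?_⟩,
          htri _ _ (by simp), fun j => htri _ _ (by simp)⟩
        rcases lt_trichotomy (i : ℕ) j with hij | hij | hij
        · obtain ⟨hd, h1, h2⟩ := hup i.succ j.succ (by simpa using hij)
          rw [if_neg (by rintro rfl; omega)]
          exact Int.eq_zero_of_dvd_of_nonneg_of_lt h1 (by simpa using h2) hd
        · obtain rfl := Fin.ext hij
          simpa using hdiag i.succ
        · rw [if_neg (by rintro rfl; omega)]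
          exact htri _ _ (by simpa using hij)
      ext i j
      exact h i j
    refine ⟨b, hA, fun j => ?_, ?_⟩
    · obtain ⟨-, h1, h2⟩ := hup 0 j.succ (by simp)
      rw [hb] at h1 h2
      refine ⟨nonneg_of_mul_nonneg_right h1 hp', lt_of_mul_lt_mul_left (a := (p : ℤ)) ?_ hp'.le⟩
      simpa [← pow_succ'] using h2
    · rw [← forall_exists_mulVec_iff hp, ← hA]
      exact hmul
  · rintro ⟨b, rfl, hb, hmul⟩
    refine ⟨?_, ?_, mat_last p b, ?_, (forall_exists_mulVec_iff hp b).2 hmul⟩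
    · simp only [forall_fin (k := k), mat_mid_zero, mat_mid_mid, mat_last_castSucc]
      refine ⟨by simp, fun i => ⟨by simp, fun j h => ?_, fun h => ?_⟩, by simp⟩
      · rw [if_neg]
        rintro rfl
        simp at h
      · simp at h
        omega
    · rw [Fin.forall_fin_succ]
      simp only [mat_zero_zero, mat_mid_mid]
      simp
    · simp only [Fin.forall_fin_succ (n := k), mat_zero_mid, mat_mid_mid]
      refine ⟨⟨by simp, fun j _ => ?_⟩, fun i => ⟨by simp, fun j h => ?_⟩⟩
      · have := mul_lt_mul_of_pos_left (hb j).2 hp'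
        exact ⟨dvd_mul_right _ _, mul_nonneg hp'.le (hb j).1, by simpa [← pow_succ'] using this⟩
      · rw [if_neg (by rintro rfl; simp at h)]
        simpa using hp'

/-- The vector with entries `p ^ 2 * c j`, plus `1` at the position `s`, if any. -/
def vec (p : ℕ) (s : Option (Fin k)) (c : Fin k → Fin p) (j : Fin k) : ℤ :=
  (p : ℤ) ^ 2 * (c j : ℕ) + if s = some j then 1 else 0

theorem vec_injective {p : ℕ} (hp : 1 < p) {s t : Option (Fin k)} {c d : Fin k → Fin p}
    (h : vec p s c = vec p t d) : s = t ∧ c = d := by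
  have hp2 : (1 : ℤ) < (p : ℤ) ^ 2 := one_lt_pow₀ (by exact_mod_cast hp) two_ne_zero
  have key : ∀ j, (s = some j ↔ t = some j) ∧ c j = d j := by
    intro j
    have hj := congr_fun h j
    simp only [vec] at hj
    have hite : (if s = some j then (1 : ℤ) else 0) = if t = some j then 1 else 0 := by
      have := congr_arg (· % (p : ℤ) ^ 2) hj
      simp only [Int.mul_add_emod_self_left] at this
      rwa [Int.emod_eq_of_lt, Int.emod_eq_of_lt] at this <;> split_ifs <;> omega
    rw [hite, add_left_inj] at hj
    have hc := mul_left_cancel₀ (by omega) hj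
    refine ⟨?_, Fin.ext (by exact_mod_cast hc)⟩
    by_cases h1 : s = some j <;> by_cases h2 : t = some j <;> simp_all
  exact ⟨Option.ext fun j => (key j).1, funext fun j => (key j).2⟩

theorem exists_vec_iff {p : ℕ} (hp : p.Prime) (b : Fin k → ℤ) :
    (∃ s c, b = vec p s c) ↔ (∀ j, 0 ≤ b j ∧ b j < (p : ℤ) ^ 3) ∧
      ∀ i j : Fin k, (p : ℤ) ^ 2 ∣ b i * b j - if i = j then b j else 0 := by
  have hp1 : (1 : ℤ) < p := by exact_mod_cast hp.one_lt
  have hp2 : (1 : ℤ) < (p : ℤ) ^ 2 := one_lt_pow₀ hp1 two_ne_zero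
  constructor
  · rintro ⟨s, c, rfl⟩
    refine ⟨fun j => ?_, fun i j => ?_⟩
    · have h1 : (0 : ℤ) ≤ (c j : ℕ) := by positivity
      have h2 : ((c j : ℕ) : ℤ) + 1 ≤ p := by exact_mod_cast (c j).2
      have h3 : (p : ℤ) ^ 2 * ((c j : ℕ) + 1) ≤ (p : ℤ) ^ 2 * p :=
        mul_le_mul_of_nonneg_left h2 (by positivity)
      rw [show (p : ℤ) ^ 2 * p = (p : ℤ) ^ 3 by ring, mul_add] at h3
      have h4 : 0 ≤ (p : ℤ) ^ 2 * (c j : ℕ) := by positivity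
      simp only [vec]
      split_ifs <;> constructor <;> omega
    · have hmod : ∀ l, vec p s c l ≡ if s = some l then 1 else 0 [ZMOD (p : ℤ) ^ 2] := by
        intro l
        simp [vec, Int.ModEq]
      rw [← Int.modEq_iff_dvd]
      refine Int.ModEq.symm (((hmod i).mul (hmod j)).trans ?_)
      by_cases hij : i = j
      · subst hij
        simpa [← ite_and] using (hmod i).symm
      · have : ¬(s = some i ∧ s = some j) := by
          rintro ⟨h1, h2⟩
          exact hij (Option.some_injective _ (h1.symm.trans h2))
        rw [if_neg hij]
        split_ifs <;> simp_all
  · rintro ⟨hb, hd⟩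
    have hcase : ∀ j, ∃ ε : ℤ, ∃ c : Fin p, b j = (p : ℤ) ^ 2 * (c : ℕ) + ε ∧ (ε = 0 ∨ ε = 1) := by
      intro j
      have h := hd j j
      rw [if_pos rfl, show b j * b j - b j = b j * (b j - 1) by ring] at h
      have hco : IsCoprime (b j) (b j - 1) := ⟨1, -1, by ring⟩
      have h' : (p : ℤ) ^ 2 ∣ b j ∨ (p : ℤ) ^ 2 ∣ b j - 1 := by
        have hpp : Prime (p : ℤ) := Nat.prime_iff_prime_int.1 hp
        by_cases hdvd : (p : ℤ) ∣ b j
        · left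
          refine IsCoprime.dvd_of_dvd_mul_right (IsCoprime.pow_left ?_) h
          exact hco.of_isCoprime_of_dvd_left hdvd
        · right
          refine IsCoprime.dvd_of_dvd_mul_left (IsCoprime.pow_left ?_) h
          exact (hpp.irreducible.coprime_iff_not_dvd).2 hdvd
      obtain ⟨ε, hε, q, hq⟩ : ∃ ε : ℤ, (ε = 0 ∨ ε = 1) ∧ (p : ℤ) ^ 2 ∣ b j - ε := by
        rcases h' with h' | h'
        · exact ⟨0, .inl rfl, by simpa using h'⟩
        · exact ⟨1, .inr rfl, h'⟩
      have hq0 : 0 ≤ q := by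
        by_contra! hneg
        have := (hb j).1
        have := mul_le_mul_of_nonneg_left (show q ≤ -1 by omega) (show 0 ≤ (p : ℤ) ^ 2 by omega)
        omega
      have hqp : q < p := by
        by_contra! hge
        have := (hb j).2
        have := mul_le_mul_of_nonneg_left hge (show 0 ≤ (p : ℤ) ^ 2 by omega)
        rw [show (p : ℤ) ^ 2 * p = (p : ℤ) ^ 3 by ring] at this
        omega
      lift q to ℕ using hq0
      exact ⟨ε, ⟨q, by exact_mod_cast hqp⟩, by linarith, hε⟩
    choose ε c hbc hε using hcase
    have huniq : ∀ i j, ε i = 1 → ε j = 1 → i = j := by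
      intro i j hi hj
      by_contra hij
      have h := hd i j
      rw [if_neg hij, hbc, hbc, hi, hj] at h
      have h1 : (p : ℤ) ^ 2 ∣ 1 := by
        obtain ⟨t, ht⟩ := h
        exact ⟨t - (p : ℤ) ^ 2 * (c i : ℕ) * (c j : ℕ) - (c i : ℕ) - (c j : ℕ),
          by linear_combination ht⟩
      have := Int.le_of_dvd one_pos h1
      omega
    by_cases hs : ∃ i, ε i = 1
    · obtain ⟨i, hi⟩ := hs
      refine ⟨some i, c, funext fun j => ?_⟩
      rw [hbc, vec]
      by_cases hij : i = j
      · simp [← hij, hi]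
      · have : ε j = 0 := (hε j).resolve_right fun hj => hij (huniq i j hi hj)
        simp [hij, this]
    · refine ⟨none, c, funext fun j => ?_⟩
      have : ε j = 0 := (hε j).resolve_right fun hj => hs ⟨j, hj⟩
      simp [hbc, vec, this]

end FourOnes

open FourOnes in
/-- For a prime `p`, `n ≥ 2`, and the composition `α = (4, 1, …, 1)` of length `n-1`,
the number of irreducible subring matrices with diagonal `α` is `(n-1)·p^{n-2}`. -/
theorem gMat_four_ones (p : ℕ) (hp : p.Prime) (n : ℕ) (hn : 2 ≤ n) :
    gMat p (fun i : Fin (n - 1) => if (i : ℕ) = 0 then 4 else 1) =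
      (n - 1) * p ^ (n - 2) := by
  obtain ⟨k, rfl⟩ := Nat.exists_eq_add_of_le' hn
  change Nat.card {A // IsIrrSubringMatrix p
    (fun i : Fin (k + 1) => if (i : ℕ) = 0 then 4 else 1) A} = (k + 1) * p ^ k
  have hiff : ∀ A, IsIrrSubringMatrix p (fun i : Fin (k + 1) => if (i : ℕ) = 0 then 4 else 1) A ↔
      ∃ s c, mat p (vec p s c) = A := by
    intro A
    rw [isIrrSubringMatrix_iff hp.ne_zero]
    simp only [← exists_vec_iff hp]
    constructor
    · rintro ⟨b, rfl, s, c, rfl⟩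
      exact ⟨s, c, rfl⟩
    · rintro ⟨s, c, rfl⟩
      exact ⟨_, rfl, s, c, rfl⟩
  let f : Option (Fin k) × (Fin k → Fin p) → {A // IsIrrSubringMatrix p
      (fun i : Fin (k + 1) => if (i : ℕ) = 0 then 4 else 1) A} :=
    fun x => ⟨mat p (vec p x.1 x.2), (hiff _).2 ⟨x.1, x.2, rfl⟩⟩
  have hf : Function.Bijective f := by
    constructor
    · intro x y h
      obtain ⟨h1, h2⟩ := vec_injective hp.one_lt (mat_injective hp.ne_zero (congr_arg Subtype.val h))
      exact Prod.ext h1 h2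
    · rintro ⟨A, hA⟩
      obtain ⟨s, c, h⟩ := (hiff A).1 hA
      exact ⟨(s, c), Subtype.ext h⟩
  rw [← Nat.card_eq_of_bijective f hf]
  simp
end

section
/- Let $p$ be a prime, let $n\ge 3$, and fix $\beta>2$. For $2\le k\le n-1$ let $\alpha_k$ be the composition of length $n-1$ with first part $2$, with $\beta$ in the $k$-th position, and all other parts $1$. Then $\sum_{k=2}^{n-1} g_{\alpha_k}(p) = \frac{p^{n-3}\left((n-2)p^{n-1}-(n-1)p^{n-2}+1\right)}{(p-1)^2} + (p-1)p^{n-3}\binom{n-1}{2}$. -/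
section Counting

/-- An idempotent residue modulo `p ^ e` is `0` or `1`. -/
lemma pow_dvd_or_pow_dvd_sub_one {p e : ℕ} (hp : p.Prime) {x : ℤ}
    (h : (p : ℤ) ^ e ∣ x * x - x) : (p : ℤ) ^ e ∣ x ∨ (p : ℤ) ^ e ∣ x - 1 := by
  have hp' : Prime (p : ℤ) := Nat.prime_iff_prime_int.mp hp
  have h' : (p : ℤ) ^ e ∣ x * (x - 1) := by rwa [mul_sub, mul_one]
  by_cases hx : (p : ℤ) ∣ x
  · left
    refine hp'.pow_dvd_of_dvd_mul_right e (fun h1 => ?_) h'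
    exact hp'.not_dvd_one (by simpa using dvd_sub hx h1)
  · exact Or.inr (hp'.pow_dvd_of_dvd_mul_left e hx h')

/-- The integers `b i` form a family of orthogonal idempotents modulo `N`. -/
def OrthIdem {J : Type*} [DecidableEq J] (N : ℤ) (b : J → ℤ) : Prop :=
  ∀ i j, N ∣ b i * b j - if i = j then b i else 0

lemma OrthIdem.congr {J : Type*} [DecidableEq J] {N : ℤ} {b c : J → ℤ}
    (h : ∀ j, b j ≡ c j [ZMOD N]) : OrthIdem N b ↔ OrthIdem N c := by
  refine forall_congr' fun i => forall_congr' fun j => ?_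
  have hmod : b i * b j - (if i = j then b i else 0) ≡
      c i * c j - (if i = j then c i else 0) [ZMOD N] := by
    refine ((h i).mul (h j)).sub ?_
    split_ifs
    exacts [h i, rfl]
  rw [Int.dvd_iff_emod_eq_zero, Int.dvd_iff_emod_eq_zero, hmod.eq]

lemma card_orthIdem_reduced {J : Type*} [Fintype J] [DecidableEq J] {p e : ℕ} (hp : p.Prime)
    (he : 0 < e) :
    Nat.card {b : J → Fin (p ^ e) // OrthIdem ((p : ℤ) ^ e) fun j => (b j : ℤ)} =
      Fintype.card J + 1 := by
  have hE : 1 < p ^ e := Nat.one_lt_pow he.ne' hp.one_lt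
  have key : ∀ b : Fin (p ^ e), (p : ℤ) ^ e ∣ (b : ℤ) * b - b → (b : ℕ) = 0 ∨ (b : ℕ) = 1 := by
    intro b hb
    have hb2 := b.2
    rcases pow_dvd_or_pow_dvd_sub_one hp hb with h | h
    · left
      exact Nat.eq_zero_of_dvd_of_lt (by exact_mod_cast h) hb2
    · by_cases h0 : (b : ℕ) = 0
      · exact Or.inl h0
      · right
        have h1 : p ^ e ∣ (b : ℕ) - 1 := by
          rw [← Int.natCast_dvd_natCast]
          push_cast [Nat.one_le_iff_ne_zero.mpr h0]
          exact h
        have := Nat.eq_zero_of_dvd_of_lt h1 (by omega)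
        omega
  let f : Option J → {b : J → Fin (p ^ e) // OrthIdem ((p : ℤ) ^ e) fun j => (b j : ℤ)} :=
    fun o => ⟨fun j => if o = some j then ⟨1, hE⟩ else ⟨0, by omega⟩, by
      intro i j
      by_cases hi : o = some i <;> by_cases hj : o = some j <;> by_cases hij : i = j <;>
        simp_all⟩
  have hf : Function.Bijective f := by
    constructor
    · intro o o' h
      have h' : ∀ j, (o = some j ↔ o' = some j) := by
        intro j
        have := congrArg Fin.val (congrFun (congrArg Subtype.val h) j)
        simp only [f] at this
        split_ifs at this <;> simp_all
      exact Option.ext h'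
    · rintro ⟨b, hb⟩
      have hval : ∀ j, (b j : ℕ) = 0 ∨ (b j : ℕ) = 1 := fun j => key _ (by simpa using hb j j)
      by_cases hex : ∃ j, (b j : ℕ) = 1
      · obtain ⟨j, hj⟩ := hex
        refine ⟨some j, Subtype.ext (funext fun i => Fin.ext ?_)⟩
        by_cases hij : j = i
        · subst hij; simp [f, hj]
        · have h0 : (b i : ℕ) = 0 := by
            refine (hval i).resolve_right fun hi => ?_
            have h1 := hb j i
            simp only [hj, hi, hij, if_false] at h1
            have h2 : p ^ e ∣ 1 := by rw [← Int.natCast_dvd_natCast]; simpa using h1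
            have := Nat.le_of_dvd one_pos h2
            omega
          simp [f, hij, h0]
      · push Not at hex
        exact ⟨none, Subtype.ext (funext fun i => Fin.ext
          (by simpa [f] using ((hval i).resolve_right (hex i)).symm))⟩
  rw [← Nat.card_eq_of_bijective f hf, Nat.card_eq_fintype_card, Fintype.card_option]

lemma card_orthIdem {J : Type*} [Fintype J] [DecidableEq J] {p e d N : ℕ} (hp : p.Prime)
    (he : 0 < e) (hN : N = d + e) :
    Nat.card {b : J → Fin (p ^ N) // OrthIdem ((p : ℤ) ^ e) fun j => (b j : ℤ)} =
      (p ^ d) ^ Fintype.card J * (Fintype.card J + 1) := by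
  subst hN
  have hE : p ^ d * p ^ e = p ^ (d + e) := (pow_add p d e).symm
  let ψ : Fin (p ^ d) × Fin (p ^ e) ≃ Fin (p ^ (d + e)) := finProdFinEquiv.trans (finCongr hE)
  have hψ : ∀ t r, ((ψ (t, r) : ℕ) : ℤ) = r + (p : ℤ) ^ e * t := by
    intro t r
    simp [ψ]
  let Φ : (J → Fin (p ^ d)) × (J → Fin (p ^ e)) ≃ (J → Fin (p ^ (d + e))) :=
    (Equiv.arrowProdEquivProdArrow J (fun _ => Fin (p ^ d)) (fun _ => Fin (p ^ e))).symm.trans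
      (Equiv.piCongrRight fun _ => ψ)
  have hΦ : ∀ t r j, ((Φ (t, r) j : ℕ) : ℤ) = r j + (p : ℤ) ^ e * t j := fun t r j => hψ _ _
  have h1 : ∀ y : (J → Fin (p ^ d)) × (J → Fin (p ^ e)),
      (True ∧ OrthIdem ((p : ℤ) ^ e) fun j => (y.2 j : ℤ)) ↔
        OrthIdem ((p : ℤ) ^ e) fun j => (Φ y j : ℤ) := by
    rintro ⟨t, r⟩
    rw [true_and]
    refine OrthIdem.congr fun j => ?_
    rw [hΦ]
    exact (Int.modEq_iff_dvd.mpr ⟨t j, by ring⟩)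
  rw [← Nat.card_congr (Equiv.subtypeEquiv Φ h1),
    Nat.card_congr (Equiv.subtypeProdEquivProd (p := fun _ : J → Fin (p ^ d) => True)
      (q := fun r : J → Fin (p ^ e) => OrthIdem ((p : ℤ) ^ e) fun j => (r j : ℤ))), Nat.card_prod,
    card_orthIdem_reduced hp he,
    Nat.card_congr (Equiv.subtypeUnivEquiv fun _ : J → Fin (p ^ d) => trivial)]
  simp

end Counting

section Criterion

variable {m : ℕ} {p β : ℕ} {α : Fin m → ℕ} {z κ : Fin m}
  {A : Matrix (Fin (m + 1)) (Fin (m + 1)) ℤ}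

/-- The conditions on the entries of an irreducible subring matrix, without closure under
products. -/
def IsShape (p : ℕ) {m : ℕ} (α : Fin m → ℕ)
    (A : Matrix (Fin (m + 1)) (Fin (m + 1)) ℤ) : Prop :=
  (∀ i j : Fin (m + 1), (j : ℕ) < (i : ℕ) → A i j = 0) ∧
  (∀ i : Fin m, A i.castSucc i.castSucc = (p : ℤ) ^ α i) ∧
  (∀ i : Fin (m + 1), A i (Fin.last m) = 1) ∧
  (∀ i j : Fin m, (i : ℕ) < (j : ℕ) →
    (p : ℤ) ∣ A i.castSucc j.castSucc ∧ 0 ≤ A i.castSucc j.castSucc ∧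
      A i.castSucc j.castSucc < (p : ℤ) ^ α i)

lemma isIrrSubringMatrix_iff : IsIrrSubringMatrix p α A ↔ IsShape p α A ∧
    ∀ i j : Fin (m + 1), ∃ x : Fin (m + 1) → ℤ, A.mulVec x = fun r => A r i * A r j := by
  simp only [IsIrrSubringMatrix, IsShape, and_assoc]

lemma IsShape.eq_zero_of_exponent_one (h : IsShape p α A) {i j : Fin m} (hi : α i = 1)
    (hij : i ≠ j) : A i.castSucc j.castSucc = 0 := by
  rcases lt_or_gt_of_ne hij with hlt | hgt
  · obtain ⟨h1, h2, h3⟩ := h.2.2.2 i j hlt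
    rw [hi, pow_one] at h3
    exact Int.eq_zero_of_dvd_of_nonneg_of_lt h2 h3 h1
  · exact h.1 _ _ hgt

lemma IsShape.dvd (h : IsShape p α A) (hα : ∀ i, 0 < α i) (i j : Fin m) :
    (p : ℤ) ∣ A i.castSucc j.castSucc := by
  rcases lt_trichotomy i j with hlt | rfl | hgt
  · exact (h.2.2.2 i j hlt).1
  · rw [h.2.1]; exact dvd_pow_self _ (hα i).ne'
  · rw [h.1 _ _ hgt]; exact dvd_zero _

lemma IsShape.closed_of (h : IsShape p α A) (hz : α z = 2) (hκ : α κ = β) (hzκ : z < κ)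
    (hα : ∀ i, 0 < α i) (h1 : ∀ i, i ≠ z → i ≠ κ → α i = 1)
    (hc : ∀ i j : Fin m, κ < i → κ < j → ∃ c : ℤ,
      A κ.castSucc i.castSucc * A κ.castSucc j.castSucc
        - (if i = j then p * A κ.castSucc i.castSucc else 0) = (p : ℤ) ^ β * c ∧
      (p : ℤ) ^ 2 ∣ c * A z.castSucc κ.castSucc) (i j : Fin (m + 1)) :
    ∃ x : Fin (m + 1) → ℤ, A.mulVec x = fun r => A r i * A r j := by
  have hcol : ∀ i, A.mulVec (Pi.single i 1) = fun r => A r i := by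
    intro i; ext r; simp
  induction i using Fin.lastCases with
  | last => exact ⟨Pi.single j 1, by rw [hcol]; ext r; rw [h.2.2.1, one_mul]⟩
  | cast i =>
  induction j using Fin.lastCases with
  | last => exact ⟨Pi.single i.castSucc 1, by rw [hcol]; ext r; rw [h.2.2.1, mul_one]⟩
  | cast j =>
  have hlow : ∀ j : Fin m, j < κ → A κ.castSucc j.castSucc = 0 := fun j hj => h.1 _ _ hj
  have hdiag := h.2.1
  obtain ⟨c, hcκ, hcz⟩ : ∃ c : ℤ, A κ.castSucc i.castSucc * A κ.castSucc j.castSucc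
        - (if i = j then A i.castSucc i.castSucc * A κ.castSucc i.castSucc else 0)
          = (p : ℤ) ^ β * c ∧
      (p : ℤ) ^ 2 ∣ c * A z.castSucc κ.castSucc := by
    have hd2 : ∀ j : Fin m, (p : ℤ) ^ 2 ∣ A κ.castSucc j.castSucc * A z.castSucc κ.castSucc := by
      intro j
      rw [sq]
      exact mul_dvd_mul (h.dvd hα _ _) (h.dvd hα _ _)
    rcases lt_trichotomy i κ with hi | rfl | hi
    · exact ⟨0, by simp [hlow i hi], by simp⟩
    · by_cases hij : i = j
      · subst hij; exact ⟨0, by simp, by simp⟩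
      · exact ⟨A i.castSucc j.castSucc, by simp [hij, hdiag, hκ], hd2 j⟩
    · rcases lt_trichotomy j κ with hj | rfl | hj
      · exact ⟨0, by simp [hlow j hj, (hj.trans hi).ne'], by simp⟩
      · exact ⟨A j.castSucc i.castSucc, by simp [hi.ne', hdiag, hκ, mul_comm], hd2 i⟩
      · obtain ⟨c, h2, h3⟩ := hc i j hi hj
        refine ⟨c, ?_, h3⟩
        rw [← h2, hdiag, h1 i (hzκ.trans hi).ne' hi.ne', pow_one]
  obtain ⟨t, ht⟩ : (p : ℤ) ^ 2 ∣ A z.castSucc i.castSucc * A z.castSucc j.castSucc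
      - (if i = j then A i.castSucc i.castSucc * A z.castSucc i.castSucc else 0)
      - c * A z.castSucc κ.castSucc := by
    refine dvd_sub (dvd_sub ?_ ?_) hcz
    · rw [sq]; exact mul_dvd_mul (h.dvd hα _ _) (h.dvd hα _ _)
    · split_ifs
      · rw [sq]; exact mul_dvd_mul (h.dvd hα _ _) (h.dvd hα _ _)
      · exact dvd_zero _
  refine ⟨(if i = j then A i.castSucc i.castSucc else 0) • Pi.single i.castSucc 1
    + c • Pi.single κ.castSucc 1 + t • Pi.single z.castSucc 1, ?_⟩
  rw [Matrix.mulVec_add, Matrix.mulVec_add, Matrix.mulVec_smul, Matrix.mulVec_smul,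
    Matrix.mulVec_smul, hcol, hcol, hcol]
  ext r
  simp only [Pi.add_apply, Pi.smul_apply, smul_eq_mul]
  induction r using Fin.lastCases with
  | last =>
    have hl : ∀ j : Fin m, A (Fin.last m) j.castSucc = 0 := fun j => h.1 _ _ j.2
    simp [hl]
  | cast r =>
  by_cases hrz : r = z
  · subst hrz
    rw [hdiag r, hz]
    split_ifs at ht ⊢ <;> linarith
  by_cases hrκ : r = κ
  · subst hrκ
    rw [hdiag r, hκ, hlow z hzκ]
    split_ifs at hcκ ⊢ <;> linarith
  have hr : ∀ j, r ≠ j → A r.castSucc j.castSucc = 0 := fun j hj =>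
    h.eq_zero_of_exponent_one (h1 r hrz hrκ) hj
  rw [hr z hrz, hr κ hrκ]
  by_cases hij : i = j
  · subst hij
    by_cases hri : r = i
    · subst hri; simp
    · simp [hr i hri]
  · by_cases hri : r = i
    · subst hri; simp [hij, hr j hij]
    · simp [hij, hr i hri]

lemma IsShape.of_closed (h : IsShape p α A) (hp : p ≠ 0) (hz : α z = 2) (hκ : α κ = β)
    (hzκ : z < κ) (h1 : ∀ i, i ≠ z → i ≠ κ → α i = 1)
    (hc : ∀ i j : Fin (m + 1), ∃ x : Fin (m + 1) → ℤ, A.mulVec x = fun r => A r i * A r j)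
    (hα : ∀ i, 0 < α i) (i j : Fin m) (hi : κ < i) (hj : κ < j) : ∃ c : ℤ,
      A κ.castSucc i.castSucc * A κ.castSucc j.castSucc
        - (if i = j then p * A κ.castSucc i.castSucc else 0) = (p : ℤ) ^ β * c ∧
      (p : ℤ) ^ 2 ∣ c * A z.castSucc κ.castSucc := by
  obtain ⟨x, hx⟩ := hc i.castSucc j.castSucc
  have hdiag := h.2.1
  set d : ℤ := if i = j then (p : ℤ) else 0 with hd
  have hpd : (p : ℤ) ∣ d := by rw [hd]; split_ifs <;> simp
  set y : Fin (m + 1) → ℤ := x - d • Pi.single i.castSucc 1 with hy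
  have hAy : ∀ r, ∑ s, A r s * y s = A r i.castSucc * A r j.castSucc - d * A r i.castSucc := by
    intro r
    have : A.mulVec y r = A r i.castSucc * A r j.castSucc - d * A r i.castSucc := by
      rw [hy, Matrix.mulVec_sub, Matrix.mulVec_smul, hx]
      simp
    exact this
  have hl : ∀ j : Fin m, A (Fin.last m) j.castSucc = 0 := fun j => h.1 _ _ j.2
  have hylast : y (Fin.last m) = 0 := by
    have := hAy (Fin.last m)
    simpa [Fin.sum_univ_castSucc, hl, h.2.2.1] using this
  have hyr : ∀ r : Fin m, r ≠ z → r ≠ κ → y r.castSucc = 0 := by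
    intro r hrz hrκ
    have hr : ∀ j, r ≠ j → A r.castSucc j.castSucc = 0 := fun j hj =>
      h.eq_zero_of_exponent_one (h1 r hrz hrκ) hj
    have hrr : A r.castSucc r.castSucc = p := by rw [hdiag, h1 r hrz hrκ, pow_one]
    have h2 := hAy r.castSucc
    rw [Fin.sum_univ_castSucc, hylast, mul_zero, add_zero,
      Fintype.sum_eq_single r (fun s hs => by rw [hr s hs.symm, zero_mul]), hrr] at h2
    have h3 : A r.castSucc i.castSucc * A r.castSucc j.castSucc - d * A r.castSucc i.castSucc
        = 0 := by
      by_cases hri : r = i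
      · subst hri
        by_cases hrj : r = j
        · subst hrj; simp [hd, hrr]
        · simp [hd, hrj, hr j hrj]
      · simp [hr i hri]
    rw [h3] at h2
    exact (mul_eq_zero.mp h2).resolve_left (by exact_mod_cast hp)
  have hsum : ∀ r : Fin m, A r.castSucc z.castSucc * y z.castSucc
      + A r.castSucc κ.castSucc * y κ.castSucc =
      A r.castSucc i.castSucc * A r.castSucc j.castSucc - d * A r.castSucc i.castSucc := by
    intro r
    rw [← hAy, Fin.sum_univ_castSucc, hylast, mul_zero, add_zero,
      Fintype.sum_eq_add z κ hzκ.ne (fun s hs => by rw [hyr s hs.1 hs.2, mul_zero])]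
  refine ⟨y κ.castSucc, ?_, ?_⟩
  · have := hsum κ
    rw [h.1 κ.castSucc z.castSucc hzκ, hdiag, hκ] at this
    rw [hd] at this
    split_ifs at this ⊢ <;> linarith
  · have := hsum z
    rw [hdiag, hz] at this
    have h5 : y κ.castSucc * A z.castSucc κ.castSucc =
        A z.castSucc i.castSucc * A z.castSucc j.castSucc - d * A z.castSucc i.castSucc
          - p ^ 2 * y z.castSucc := by linarith
    rw [h5]
    refine dvd_sub (dvd_sub ?_ ?_) (dvd_mul_right _ _)
    · rw [sq]; exact mul_dvd_mul (h.dvd hα _ _) (h.dvd hα _ _)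
    · rw [sq]; exact mul_dvd_mul hpd (h.dvd hα _ _)

end Criterion

section Parametrization

lemma exists_mul_eq_iff {p : ℕ} (hp : p.Prime) (M : ℕ) (x : Fin p) (u : ℤ) :
    (∃ c : ℤ, (p : ℤ) ^ 2 * u = (p : ℤ) ^ (M + 2) * c ∧ (p : ℤ) ^ 2 ∣ c * (p * (x : ℕ))) ↔
      (p : ℤ) ^ (if (x : ℕ) = 0 then M else M + 1) ∣ u := by
  have hp' : Prime (p : ℤ) := Nat.prime_iff_prime_int.mp hp
  have h0 : (p : ℤ) ≠ 0 := hp'.ne_zero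
  have h1 : ∀ c : ℤ, (p : ℤ) ^ 2 * u = (p : ℤ) ^ (M + 2) * c ↔ u = (p : ℤ) ^ M * c := by
    intro c
    rw [pow_add, mul_comm ((p : ℤ) ^ M), mul_assoc, mul_right_inj' (pow_ne_zero 2 h0)]
  have h2 : ∀ c : ℤ, (p : ℤ) ^ 2 ∣ c * (p * (x : ℕ)) ↔ (p : ℤ) ∣ c * (x : ℕ) := by
    intro c
    rw [sq, mul_left_comm, mul_dvd_mul_iff_left h0]
  simp only [h1, h2]
  split_ifs with hx
  · simp [hx, Dvd.dvd]
  · constructor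
    · rintro ⟨c, rfl, hc⟩
      rw [pow_succ]
      refine mul_dvd_mul_left _ ((hp'.dvd_or_dvd hc).resolve_right fun h => hx ?_)
      exact Nat.eq_zero_of_dvd_of_lt (by exact_mod_cast h) x.2
    · rintro ⟨c, rfl⟩
      exact ⟨p * c, by ring, (dvd_mul_right _ _).mul_right _⟩

variable {m : ℕ}

/-- The matrix with diagonal `(p ^ α i, 1)`, last column `1`, and above-diagonal entries `p * x`
at `(z, κ)`, `p * a j` elsewhere in row `z`, and `p * b j` in row `κ`. -/
def paramMatrix (p : ℕ) (α : Fin m → ℕ) (z κ : Fin m) (M : ℕ)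
    (t : Fin p × ({j : Fin m // j ≠ z ∧ j ≠ κ} → Fin p) ×
      ({j : Fin m // κ < j} → Fin (p ^ (M + 1)))) :
    Matrix (Fin (m + 1)) (Fin (m + 1)) ℤ :=
  fun i j => Fin.lastCases (motive := fun _ => ℤ) 1 (fun j => Fin.lastCases (motive := fun _ => ℤ) 0
    (fun i => if i = j then (p : ℤ) ^ α i
      else if i = z then p * ((if h : j ≠ z ∧ j ≠ κ then t.2.1 ⟨j, h⟩ else t.1 : Fin p) : ℕ)
      else if h : i = κ ∧ κ < j then p * ((t.2.2 ⟨j, h.2⟩ : Fin (p ^ (M + 1))) : ℕ)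
      else 0) i) j

variable {p M : ℕ} {α : Fin m → ℕ} {z κ : Fin m}
  {t : Fin p × ({j : Fin m // j ≠ z ∧ j ≠ κ} → Fin p) ×
    ({j : Fin m // κ < j} → Fin (p ^ (M + 1)))}

lemma paramMatrix_last (i : Fin (m + 1)) : paramMatrix p α z κ M t i (Fin.last m) = 1 := by
  simp [paramMatrix]

lemma paramMatrix_last_castSucc (j : Fin m) :
    paramMatrix p α z κ M t (Fin.last m) j.castSucc = 0 := by
  simp [paramMatrix]

lemma paramMatrix_castSucc (i j : Fin m) : paramMatrix p α z κ M t i.castSucc j.castSucc =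
    if i = j then (p : ℤ) ^ α i
      else if i = z then p * ((if h : j ≠ z ∧ j ≠ κ then t.2.1 ⟨j, h⟩ else t.1 : Fin p) : ℕ)
      else if h : i = κ ∧ κ < j then p * ((t.2.2 ⟨j, h.2⟩ : Fin (p ^ (M + 1))) : ℕ)
      else 0 := by
  simp [paramMatrix]

lemma paramMatrix_row_zero (j : {j : Fin m // j ≠ z ∧ j ≠ κ}) :
    paramMatrix p α z κ M t z.castSucc j.1.castSucc = p * (t.2.1 j : ℕ) := by
  rw [paramMatrix_castSucc, if_neg j.2.1.symm, if_pos rfl, dif_pos j.2]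

lemma paramMatrix_zero_kappa (hzκ : z < κ) :
    paramMatrix p α z κ M t z.castSucc κ.castSucc = p * (t.1 : ℕ) := by
  rw [paramMatrix_castSucc, if_neg hzκ.ne, if_pos rfl, dif_neg (by simp)]

lemma paramMatrix_row_kappa (hzκ : z < κ) (j : {j : Fin m // κ < j}) :
    paramMatrix p α z κ M t κ.castSucc j.1.castSucc = p * (t.2.2 j : ℕ) := by
  rw [paramMatrix_castSucc, if_neg j.2.ne, if_neg hzκ.ne', dif_pos ⟨rfl, j.2⟩]

lemma paramMatrix_isShape (hp : p.Prime) (hz0 : (z : ℕ) = 0) (hzκ : z < κ) (hz : α z = 2)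
    (hκ : α κ = M + 2) : IsShape p α (paramMatrix p α z κ M t) := by
  have hp0 : (0 : ℤ) < p := by exact_mod_cast hp.pos
  refine ⟨?_, fun i => by rw [paramMatrix_castSucc, if_pos rfl], paramMatrix_last, ?_⟩
  · intro i j hji
    induction j using Fin.lastCases with
    | last => simp only [Fin.val_last] at hji; omega
    | cast j =>
    induction i using Fin.lastCases with
    | last => exact paramMatrix_last_castSucc j
    | cast i =>
    have hji' : j < i := hji
    rw [paramMatrix_castSucc, if_neg hji'.ne', if_neg, dif_neg]
    · rintro ⟨rfl, h⟩; exact lt_asymm h hji'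
    · rintro rfl
      simp only [Fin.val_castSucc] at hji; omega
  · intro i j hij
    have hij' : i < j := hij
    have hlt : ∀ (y k : ℕ), y < p ^ k → (p : ℤ) ∣ p * (y : ℤ) ∧ 0 ≤ (p : ℤ) * y ∧
        (p : ℤ) * y < (p : ℤ) ^ (k + 1) := by
      intro y k hy
      refine ⟨dvd_mul_right _ _, by positivity, ?_⟩
      rw [pow_succ, mul_comm]
      exact mul_lt_mul_of_pos_right (by exact_mod_cast hy) hp0
    rw [paramMatrix_castSucc, if_neg hij'.ne]
    split_ifs with h1 h2 h3
    · subst h1; rw [hz]; exact hlt _ 1 (by rw [pow_one]; exact Fin.is_lt _)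
    · subst h1; rw [hz]; exact hlt _ 1 (by rw [pow_one]; exact Fin.is_lt _)
    · obtain ⟨rfl, h4⟩ := h3
      rw [hκ]; exact hlt _ (M + 1) (Fin.is_lt _)
    · exact ⟨dvd_zero _, le_rfl, by positivity⟩

lemma paramMatrix_injective (hp : p.Prime) (hzκ : z < κ) :
    Function.Injective (paramMatrix p α z κ M) := by
  have hp0 : (p : ℤ) ≠ 0 := by exact_mod_cast hp.ne_zero
  have hcancel : ∀ u v : ℕ, (p : ℤ) * u = p * v → u = v := fun u v h => by
    exact_mod_cast mul_left_cancel₀ hp0 h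
  rintro ⟨x, a, b⟩ ⟨x', a', b'⟩ h
  refine Prod.ext (Fin.ext (hcancel _ _ ?_)) (Prod.ext (funext fun j => Fin.ext (hcancel _ _ ?_))
    (funext fun j => Fin.ext (hcancel _ _ ?_)))
  · have := congrFun (congrFun h z.castSucc) κ.castSucc
    rwa [paramMatrix_zero_kappa hzκ, paramMatrix_zero_kappa hzκ] at this
  · have := congrFun (congrFun h z.castSucc) j.1.castSucc
    rwa [paramMatrix_row_zero, paramMatrix_row_zero] at this
  · have := congrFun (congrFun h κ.castSucc) j.1.castSucc
    rwa [paramMatrix_row_kappa hzκ, paramMatrix_row_kappa hzκ] at this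

lemma IsShape.exists_paramMatrix (hp : p.Prime) (hz0 : (z : ℕ) = 0) (hzκ : z < κ) (hz : α z = 2)
    (hκ : α κ = M + 2) (h1 : ∀ i, i ≠ z → i ≠ κ → α i = 1)
    {A : Matrix (Fin (m + 1)) (Fin (m + 1)) ℤ} (h : IsShape p α A) :
    ∃ t, paramMatrix p α z κ M t = A := by
  have hp0 : (0 : ℤ) < p := by exact_mod_cast hp.pos
  have hdiv : ∀ (y : ℤ) (k : ℕ), (p : ℤ) ∣ y ∧ 0 ≤ y ∧ y < (p : ℤ) ^ (k + 1) →
      ∃ s : ℕ, s < p ^ k ∧ y = p * s := by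
    rintro _ k ⟨⟨y, rfl⟩, h2, h3⟩
    lift y to ℕ using nonneg_of_mul_nonneg_right h2 hp0
    refine ⟨y, ?_, rfl⟩
    rw [pow_succ, mul_comm] at h3
    exact_mod_cast lt_of_mul_lt_mul_right h3 hp0.le
  have hzlt : ∀ j, j ≠ z → z < j := fun j hj => by
    have := Fin.val_ne_of_ne hj
    rw [Fin.lt_def]; omega
  have hrowz : ∀ j, j ≠ z → ∃ s : Fin p, A z.castSucc j.castSucc = p * (s : ℕ) := by
    intro j hj
    obtain ⟨s, hs, hs'⟩ := hdiv _ 1 (hz ▸ h.2.2.2 z j (hzlt j hj))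
    exact ⟨⟨s, by rwa [pow_one] at hs⟩, hs'⟩
  have hrowκ : ∀ j, κ < j → ∃ s : Fin (p ^ (M + 1)), A κ.castSucc j.castSucc = p * (s : ℕ) := by
    intro j hj
    obtain ⟨s, hs, hs'⟩ := hdiv _ (M + 1) (hκ ▸ h.2.2.2 κ j hj)
    exact ⟨⟨s, hs⟩, hs'⟩
  obtain ⟨x, hx⟩ := hrowz κ hzκ.ne'
  choose a ha using fun j : {j : Fin m // j ≠ z ∧ j ≠ κ} => hrowz j.1 j.2.1
  choose b hb using fun j : {j : Fin m // κ < j} => hrowκ j.1 j.2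
  refine ⟨(x, a, b), ?_⟩
  ext i j
  induction j using Fin.lastCases with
  | last => rw [paramMatrix_last, h.2.2.1]
  | cast j =>
  induction i using Fin.lastCases with
  | last => rw [paramMatrix_last_castSucc, h.1 _ _ j.2]
  | cast i =>
  rw [paramMatrix_castSucc]
  split_ifs with hij hiz hj hi
  · rw [← hij, h.2.1]
  · rw [hiz]; exact (ha ⟨j, hj⟩).symm
  · have hjκ : j = κ := by
      by_contra hjκ
      exact hj ⟨fun hjz => hij (hiz.trans hjz.symm), hjκ⟩
    rw [hiz, hjκ]; exact hx.symm
  · obtain ⟨rfl, hj⟩ := hi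
    exact (hb ⟨j, hj⟩).symm
  · by_cases hiκ : i = κ
    · refine (h.1 _ _ ?_).symm
      have h4 : ¬ i < j := fun h4 => hi ⟨hiκ, hiκ ▸ h4⟩
      have h5 : j < i := lt_of_le_of_ne (not_lt.mp h4) (Ne.symm hij)
      exact h5
    · exact (h.eq_zero_of_exponent_one (h1 i hiz hiκ) hij).symm

lemma paramMatrix_isIrrSubringMatrix_iff (hp : p.Prime) (hz0 : (z : ℕ) = 0) (hzκ : z < κ)
    (hz : α z = 2) (hκ : α κ = M + 2) (h1 : ∀ i, i ≠ z → i ≠ κ → α i = 1) :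
    IsIrrSubringMatrix p α (paramMatrix p α z κ M t) ↔
      OrthIdem ((p : ℤ) ^ (if (t.1 : ℕ) = 0 then M else M + 1)) fun j => (t.2.2 j : ℤ) := by
  have hα : ∀ i, 0 < α i := by
    intro i
    by_cases hiz : i = z
    · rw [hiz, hz]; exact two_pos
    by_cases hiκ : i = κ
    · rw [hiκ, hκ]; omega
    · rw [h1 i hiz hiκ]; exact one_pos
  have hS : IsShape p α (paramMatrix p α z κ M t) := paramMatrix_isShape hp hz0 hzκ hz hκ
  have hiff : ∀ i j : {j : Fin m // κ < j},
      (∃ c : ℤ, paramMatrix p α z κ M t κ.castSucc i.1.castSucc *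
          paramMatrix p α z κ M t κ.castSucc j.1.castSucc
        - (if i.1 = j.1 then p * paramMatrix p α z κ M t κ.castSucc i.1.castSucc else 0)
          = (p : ℤ) ^ (M + 2) * c ∧
        (p : ℤ) ^ 2 ∣ c * paramMatrix p α z κ M t z.castSucc κ.castSucc) ↔
      (p : ℤ) ^ (if (t.1 : ℕ) = 0 then M else M + 1) ∣
        (t.2.2 i : ℤ) * (t.2.2 j : ℤ) - if i = j then (t.2.2 i : ℤ) else 0 := by
    intro i j
    rw [← exists_mul_eq_iff hp, paramMatrix_row_kappa hzκ, paramMatrix_row_kappa hzκ,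
      paramMatrix_zero_kappa hzκ]
    have : (p : ℤ) * (t.2.2 i : ℕ) * (p * (t.2.2 j : ℕ)) -
        (if i.1 = j.1 then (p : ℤ) * (p * (t.2.2 i : ℕ)) else 0) =
        p ^ 2 * ((t.2.2 i : ℤ) * (t.2.2 j : ℤ) - if i = j then (t.2.2 i : ℤ) else 0) := by
      simp only [Subtype.ext_iff]
      split_ifs <;> ring
    rw [this]
  rw [isIrrSubringMatrix_iff]
  constructor
  · rintro ⟨-, hc⟩ i j
    exact (hiff i j).mp (hS.of_closed hp.ne_zero hz hκ hzκ h1 hc hα i.1 j.1 i.2 j.2)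
  · intro ho
    exact ⟨hS, hS.closed_of hz hκ hzκ hα h1 fun i j hi hj => (hiff ⟨i, hi⟩ ⟨j, hj⟩).mpr (ho _ _)⟩

end Parametrization

/-- The number of irreducible subring matrices whose diagonal exponents are `2` first, `M + 2` at
position `κ`, and `1` elsewhere. -/
lemma gMat_eq {m : ℕ} {p M : ℕ} {α : Fin m → ℕ} {z κ : Fin m} (hp : p.Prime) (hM : 0 < M)
    (hz0 : (z : ℕ) = 0) (hzκ : z < κ) (hz : α z = 2) (hκ : α κ = M + 2)
    (h1 : ∀ i, i ≠ z → i ≠ κ → α i = 1) :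
    gMat p α = p ^ (m - 2) * ((m - 1 - κ + 1) * (p ^ (m - 1 - κ) + (p - 1))) := by
  let T := Fin p × ({j : Fin m // j ≠ z ∧ j ≠ κ} → Fin p) ×
    ({j : Fin m // κ < j} → Fin (p ^ (M + 1)))
  let e : Fin p → ℕ := fun x => if (x : ℕ) = 0 then M else M + 1
  let G : Fin p → ({j : Fin m // κ < j} → Fin (p ^ (M + 1))) → Prop :=
    fun x b => OrthIdem ((p : ℤ) ^ e x) fun j => (b j : ℤ)
  let f : {t : T // G t.1 t.2.2} →
      {A : Matrix (Fin (m + 1)) (Fin (m + 1)) ℤ // IsIrrSubringMatrix p α A} := fun t =>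
    ⟨paramMatrix p α z κ M t.1, (paramMatrix_isIrrSubringMatrix_iff hp hz0 hzκ hz hκ h1).mpr t.2⟩
  have hf : Function.Bijective f := by
    constructor
    · intro t t' h
      exact Subtype.ext (paramMatrix_injective hp hzκ (congrArg Subtype.val h))
    · rintro ⟨A, hA⟩
      obtain ⟨t, rfl⟩ := (isIrrSubringMatrix_iff.mp hA).1.exists_paramMatrix hp hz0 hzκ hz hκ h1
      exact ⟨⟨t, (paramMatrix_isIrrSubringMatrix_iff hp hz0 hzκ hz hκ h1).mp hA⟩, rfl⟩
  let g : {t : T // G t.1 t.2.2} ≃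
      ({j : Fin m // j ≠ z ∧ j ≠ κ} → Fin p) × (Σ x : Fin p, {b // G x b}) :=
    { toFun := fun t => (t.1.2.1, ⟨t.1.1, t.1.2.2, t.2⟩)
      invFun := fun s => ⟨(s.2.1, s.1, s.2.2.1), s.2.2.2⟩
      left_inv := fun _ => rfl
      right_inv := fun _ => rfl }
  have hK : Fintype.card {j : Fin m // j ≠ z ∧ j ≠ κ} = m - 2 := by
    rw [Fintype.card_subtype]
    have : (Finset.univ.filter fun j : Fin m => j ≠ z ∧ j ≠ κ) = (Finset.univ.erase z).erase κ := by
      ext j; simp [and_comm]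
    rw [this, Finset.card_erase_of_mem (by simp [hzκ.ne']), Finset.card_erase_of_mem (by simp),
      Finset.card_univ, Fintype.card_fin]
    omega
  have hJ : Fintype.card {j : Fin m // κ < j} = m - 1 - κ := by
    rw [Fintype.card_subtype, Finset.filter_lt_eq_Ioi, Fin.card_Ioi]
  have hcard : ∀ x, Nat.card {b // G x b} =
      (m - 1 - κ + 1) * if (x : ℕ) = 0 then p ^ (m - 1 - κ) else 1 := by
    intro x
    have hex : 0 < e x ∧ M + 1 = (if (x : ℕ) = 0 then 1 else 0) + e x := by
      simp only [e]; split_ifs <;> omega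
    rw [card_orthIdem hp hex.1 hex.2, hJ, mul_comm]
    split_ifs <;> simp
  obtain ⟨q, rfl⟩ : ∃ q, p = q + 1 := ⟨p - 1, (Nat.succ_pred_eq_of_pos hp.pos).symm⟩
  rw [gMat, ← Nat.card_eq_of_bijective f hf, Nat.card_congr g, Nat.card_prod, Nat.card_sigma]
  simp only [hcard]
  rw [← Finset.mul_sum, Fin.sum_univ_succ]
  simp [hK]

lemma sum_range_succ_mul_pow {x : ℚ} (hx : x ≠ 1) (r : ℕ) :
    ∑ N ∈ Finset.range (r + 1), ((N : ℚ) + 1) * x ^ N =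
      (((r : ℚ) + 1) * x ^ (r + 2) - ((r : ℚ) + 2) * x ^ (r + 1) + 1) / (x - 1) ^ 2 := by
  have h : x - 1 ≠ 0 := sub_ne_zero.mpr hx
  rw [eq_div_iff (pow_ne_zero 2 h)]
  induction r with
  | zero => simp; ring
  | succ r ih => rw [Finset.sum_range_succ, add_mul, ih]; push_cast; ring

lemma sum_range_succ_eq_choose (r : ℕ) :
    ∑ N ∈ Finset.range (r + 1), ((N : ℚ) + 1) = (Nat.choose (r + 2) 2 : ℚ) := by
  induction r with
  | zero => simp
  | succ r ih =>
    rw [Finset.sum_range_succ, ih, Nat.choose_succ_succ' (r + 2) 1, Nat.choose_one_right]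
    push_cast
    ring

/-- For a prime `p`, `n ≥ 3` and fixed `β > 2`, summing `g_{α_k}(p)` over the compositions
`α_k` of length `n-1` with first part `2`, `β` in the `k`-th position (`2 ≤ k ≤ n-1`), and
all other parts `1`:
`∑_{k=2}^{n-1} g_{α_k}(p) = p^{n-3}((n-2)p^{n-1} - (n-1)p^{n-2} + 1)/(p-1)²
  + (p-1)p^{n-3}·C(n-1, 2)`. -/
theorem gMat_two_beta_sum (p : ℕ) (hp : p.Prime) (n β : ℕ) (hn : 3 ≤ n) (hβ : 2 < β) :
    (∑ k ∈ Finset.Icc 2 (n - 1),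
        (gMat p (fun i : Fin (n - 1) =>
          if (i : ℕ) = 0 then 2 else if (i : ℕ) + 1 = k then β else 1) : ℚ)) =
      (p : ℚ) ^ (n - 3) * (((n : ℚ) - 2) * (p : ℚ) ^ (n - 1)
          - ((n : ℚ) - 1) * (p : ℚ) ^ (n - 2) + 1) / ((p : ℚ) - 1) ^ 2
        + ((p : ℚ) - 1) * (p : ℚ) ^ (n - 3) * (Nat.choose (n - 1) 2 : ℚ) := by
  obtain ⟨r, rfl⟩ : ∃ r, n = r + 3 := ⟨n - 3, by omega⟩
  obtain ⟨M, rfl⟩ : ∃ M, β = M + 2 := ⟨β - 2, by omega⟩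
  have hp1 : (p : ℚ) ≠ 1 := by exact_mod_cast hp.one_lt.ne'
  have hterm : ∀ k ∈ Finset.Icc 2 (r + 3 - 1),
      (gMat p (fun i : Fin (r + 3 - 1) =>
          if (i : ℕ) = 0 then 2 else if (i : ℕ) + 1 = k then M + 2 else 1) : ℚ) =
        (p : ℚ) ^ r * (((r + 2 - k : ℕ) : ℚ) + 1) * ((p : ℚ) ^ (r + 2 - k) + ((p : ℚ) - 1)) := by
    intro k hk
    rw [Finset.mem_Icc] at hk
    rw [gMat_eq (z := ⟨0, by omega⟩) (κ := ⟨k - 1, by omega⟩) (M := M) hp (by omega) rfl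
      (by rw [Fin.lt_def]; simp only; omega) (by simp)
      (by simp only; rw [if_neg (by omega), if_pos (by omega)])
      (fun i hi hi' => by
        rw [Ne, Fin.ext_iff] at hi hi'
        simp only at hi hi'
        rw [if_neg hi, if_neg (by omega)])]
    have h3 : r + 3 - 1 - 1 - (k - 1) = r + 2 - k := by omega
    have h4 : r + 3 - 1 - 2 = r := by omega
    simp only [h3, h4]
    push_cast [hp.one_le]
    ring
  rw [Finset.sum_congr rfl hterm]
  have hre : ∀ F : ℕ → ℚ, ∑ k ∈ Finset.Icc 2 (r + 3 - 1), F (r + 2 - k) =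
      ∑ N ∈ Finset.range (r + 1), F N := by
    intro F
    refine Finset.sum_nbij' (fun k => r + 2 - k) (fun N => r + 2 - N) ?_ ?_ ?_ ?_ ?_ <;>
      intro k hk <;> simp only [Finset.mem_Icc, Finset.mem_range] at hk ⊢ <;> omega
  rw [hre fun N => (p : ℚ) ^ r * ((N : ℚ) + 1) * ((p : ℚ) ^ N + ((p : ℚ) - 1))]
  have hsplit : ∀ N : ℕ, (p : ℚ) ^ r * ((N : ℚ) + 1) * ((p : ℚ) ^ N + ((p : ℚ) - 1)) =
      (p : ℚ) ^ r * (((N : ℚ) + 1) * (p : ℚ) ^ N) +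
        ((p : ℚ) - 1) * (p : ℚ) ^ r * ((N : ℚ) + 1) := fun N => by ring
  simp only [hsplit]
  rw [Finset.sum_add_distrib, ← Finset.mul_sum, ← Finset.mul_sum, sum_range_succ_mul_pow hp1,
    sum_range_succ_eq_choose]
  have h5 : r + 3 - 3 = r := by omega
  have h6 : r + 3 - 1 = r + 2 := by omega
  have h7 : r + 3 - 2 = r + 1 := by omega
  rw [h5, h6, h7]
  push_cast
  ring
end
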